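/- arXiv:1510.00221 — 2 statements merged into one kernel-verified Lean document; each statement's English description precedes it below -/
import Mathlib

section
/- Let F : ℂ³ → ℂ³ be a dominant polynomial mapping of degree 2 with S_F ≠ ∅. If P is an irreducible nonconstant polynomial in three complex variables whose zero set is contained in S_F, then the total degree of P satisfies 1 ≤ deg P ≤ 2. -/
open Filter Topology

/-- The asymptotic set of a mapping `F : ℂⁿ → ℂⁿ`. -/
def asymptoticSet {n : ℕ} (F : (Fin n → ℂ) → (Fin n → ℂ)) : Set (Fin n → ℂ) :=
  {a | ∃ ξ : ℕ → (Fin n → ℂ),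
    Tendsto (fun k => ‖ξ k‖) atTop atTop ∧ Tendsto (fun k => F (ξ k)) atTop (nhds a)}

/-- A plane in `ℂ³`: the zero set of a polynomial of total degree 1. -/
def IsPlane (S : Set (Fin 3 → ℂ)) : Prop :=
  ∃ Q : MvPolynomial (Fin 3) ℂ, Q.totalDegree = 1 ∧
    S = {x | MvPolynomial.eval x Q = 0}

/-- A paraboloid in `ℂ³`: the zero set of a polynomial of the form
`r·x_i² + s·x_j + t·x_l + u` where `{i, j, l} = {1, 2, 3}`, `r ≠ 0` and `(s, t) ≠ (0, 0)`. -/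
def IsParaboloid (S : Set (Fin 3 → ℂ)) : Prop :=
  ∃ (i j l : Fin 3) (r s t u : ℂ),
    i ≠ j ∧ j ≠ l ∧ i ≠ l ∧ r ≠ 0 ∧ (s, t) ≠ (0, 0) ∧
    S = {x | r * (x i) ^ 2 + s * x j + t * x l + u = 0}

/-- `F : ℂ³ → ℂ³` is a polynomial mapping of degree 2 with coordinate polynomials `P`. -/
def IsDegTwoPolyMap (P : Fin 3 → MvPolynomial (Fin 3) ℂ)
    (F : (Fin 3 → ℂ) → (Fin 3 → ℂ)) : Prop :=
  (∀ x i, F x i = MvPolynomial.eval x (P i)) ∧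
  (∀ i, (P i).totalDegree ≤ 2) ∧ (∃ i, (P i).totalDegree = 2)

/-- A field extension of `ℂ` with a standard part: `Lim x a` says that `x` is infinitely close
to the complex number `a`, and every element either has a limit or is infinite. -/
class LimitField (K : Type) extends Field K where
  /-- The embedding of the constants. -/
  cst : ℂ →+* K
  /-- The relation of being infinitely close to a constant. -/
  Lim : K → ℂ → Prop
  lim_cst : ∀ c, Lim (cst c) c
  lim_add : ∀ {x y a b}, Lim x a → Lim y b → Lim (x + y) (a + b)
  lim_mul : ∀ {x y a b}, Lim x a → Lim y b → Lim (x * y) (a * b)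
  lim_unique : ∀ {x a b}, Lim x a → Lim x b → a = b
  lim_or_inv : ∀ x, (∃ a, Lim x a) ∨ (x ≠ 0 ∧ Lim x⁻¹ 0)

namespace LimitField

variable {K : Type} [LimitField K]

lemma lim_neg {x : K} {a : ℂ} (h : Lim x a) : Lim (-x) (-a) := by
  have := lim_mul (lim_cst (K := K) (-1)) h
  simpa using this

lemma lim_sub {x y : K} {a b : ℂ} (h : Lim x a) (h' : Lim y b) : Lim (x - y) (a - b) := by
  simpa [sub_eq_add_neg] using lim_add h (lim_neg h')

lemma lim_zero : Lim (0 : K) 0 := by simpa using lim_cst (K := K) 0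

lemma lim_one : Lim (1 : K) 1 := by simpa using lim_cst (K := K) 1

lemma lim_pow {x : K} {a : ℂ} (h : Lim x a) (n : ℕ) : Lim (x ^ n) (a ^ n) := by
  induction n with
  | zero => simpa using lim_one
  | succ n ih => simpa [pow_succ] using lim_mul ih h

lemma cst_eq_zero {c : ℂ} : cst (K := K) c = 0 ↔ c = 0 := map_eq_zero _

lemma lim_cst_eq {c a : ℂ} (h : Lim (cst (K := K) c) a) : c = a := lim_unique (lim_cst c) h

/-- Finite elements. -/
def Fin' (x : K) : Prop := ∃ a, Lim x a

/-- Infinite elements. -/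
def Infinite' (x : K) : Prop := x ≠ 0 ∧ Lim x⁻¹ 0

lemma not_fin {x : K} : ¬ Fin' x ↔ Infinite' x := by
  refine ⟨fun h => (lim_or_inv x).resolve_left h, ?_⟩
  rintro ⟨h0, h⟩ ⟨a, ha⟩
  have := lim_mul ha h
  rw [mul_inv_cancel₀ h0, mul_zero] at this
  exact one_ne_zero (lim_unique lim_one this)

lemma Infinite'.not_lim {x : K} (h : Infinite' x) {a : ℂ} : ¬ Lim x a :=
  fun ha => not_fin.2 h ⟨a, ha⟩

lemma lim_inv {x : K} {a : ℂ} (h : Lim x a) (ha : a ≠ 0) : Lim x⁻¹ a⁻¹ := by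
  have hx : x ≠ 0 := by
    rintro rfl
    exact ha (lim_unique h lim_zero)
  rcases lim_or_inv x⁻¹ with ⟨b, hb⟩ | ⟨_, hb⟩
  · have := lim_mul h hb
    rw [mul_inv_cancel₀ hx] at this
    have h1 := lim_unique lim_one this
    rw [eq_comm, mul_comm, mul_eq_one_iff_eq_inv₀ ha] at h1
    rwa [h1] at hb
  · rw [inv_inv] at hb
    exact absurd (lim_unique h hb) ha

lemma Infinite'.lim_div {x y : K} {a : ℂ} (h : Infinite' x) (hy : Lim y a) :
    Lim (y * x⁻¹) 0 := by simpa using lim_mul hy h.2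

/-- If `F = t + W * S` with `F`, `t` finite and `W` infinite, then `S` is infinitesimal. -/
lemma peel {W F t S : K} {a b : ℂ} (hW : Infinite' W) (hF : Lim F a) (ht : Lim t b)
    (h : F = t + W * S) : Lim S 0 := by
  have hS : S = (F - t) * W⁻¹ := by
    rw [h]; field_simp [hW.1]; ring
  rw [hS]
  exact hW.lim_div (lim_sub hF ht)

lemma Infinite'.mul_lim {x y : K} {a : ℂ} (hx : Infinite' x) (hy : Lim y a) (ha : a ≠ 0) :
    Infinite' (x * y) := by
  rw [← not_fin]
  rintro ⟨b, hb⟩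
  have := lim_mul hb (lim_inv hy ha)
  rw [mul_assoc, mul_inv_cancel₀, mul_one] at this
  · exact hx.not_lim this
  · rintro rfl
    exact ha (lim_unique hy lim_zero)

end LimitField

section

open LimitField

/-- The asymptotic set of a mapping over a field with limits: the limits of its values at points
that are not finite. -/
def infSet {K : Type} [LimitField K] (Φ : (Fin 3 → K) → Fin 3 → K) : Set (Fin 3 → ℂ) :=
  {a | ∃ x, ¬ (∀ i, Fin' (x i)) ∧ ∀ i, Lim (Φ x i) (a i)}

/-- The values of `Φ` do not lie on a surface with a polynomial parametrization. -/
def NotOnSurface {K : Type} [LimitField K] (Φ : (Fin 3 → K) → Fin 3 → K) : Prop :=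
  ∀ G : Fin 3 → MvPolynomial (Fin 2) ℂ,
    ¬ ∀ x, ∃ s : Fin 2 → K, ∀ i, Φ x i = (G i).eval₂ cst s

/-- The bilinear form with the given coefficients. -/
def bil {R : Type} [CommRing R] (A : Fin 3 → Fin 3 → R) (x y : Fin 3 → R) : R :=
  ∑ j, ∑ k, A j k * x j * y k

/-- Infinite subsets of affine space have points over `K` that are not constant. -/
def HasGenericPoints (K : Type) [LimitField K] : Prop :=
  ∀ B : Set (Fin 3 → ℂ), B.Infinite → ∃ w : Fin 3 → K,
    (∀ p : MvPolynomial (Fin 3) ℂ, (∀ b ∈ B, p.eval b = 0) → p.eval₂ cst w = 0) ∧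
      ∀ v : Fin 3 → ℂ, w ≠ fun i => cst (K := K) (v i)

section LinearAlgebra

open Matrix

lemma exists_matrix_of_det_ne_zero (v w u : Fin 3 → ℂ) (h : (Matrix.of ![v, w, u]).det ≠ 0) :
    ∃ V V' : Matrix (Fin 3) (Fin 3) ℂ, V * V' = 1 ∧ V' * V = 1 ∧
      (∀ i, V i 0 = v i) ∧ (∀ i, V i 1 = w i) ∧ (∀ i, V i 2 = u i) := by
  have hu : IsUnit (Matrix.of ![v, w, u])ᵀ.det := by
    rw [Matrix.det_transpose]
    exact isUnit_iff_ne_zero.2 h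
  exact ⟨_, _, Matrix.mul_nonsing_inv _ hu, Matrix.nonsing_inv_mul _ hu, fun _ => rfl,
    fun _ => rfl, fun _ => rfl⟩

lemma det_of_eq_dotProduct (v w u : Fin 3 → ℂ) :
    (Matrix.of ![v, w, u]).det = - (w ⬝ᵥ (v ⨯₃ u)) := by
  simp [Matrix.det_fin_three, cross_apply, dotProduct, Fin.sum_univ_three]
  ring

lemma exists_dotProduct_ne_zero {n : Fin 3 → ℂ} (h : n ≠ 0) : ∃ w : Fin 3 → ℂ, w ⬝ᵥ n ≠ 0 := by
  by_contra! h'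
  exact h (funext fun i => by simpa using h' (Pi.single i 1))

lemma exists_matrix_of_cross_ne_zero {v u : Fin 3 → ℂ} (h : v ⨯₃ u ≠ 0) :
    ∃ V V' : Matrix (Fin 3) (Fin 3) ℂ, V * V' = 1 ∧ V' * V = 1 ∧
      (∀ i, V i 0 = v i) ∧ (∀ i, V i 2 = u i) := by
  obtain ⟨w, hw⟩ := exists_dotProduct_ne_zero h
  obtain ⟨V, V', h1, h2, h3, -, h5⟩ := exists_matrix_of_det_ne_zero v w u (by
    rw [det_of_eq_dotProduct]
    exact neg_ne_zero.2 hw)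
  exact ⟨V, V', h1, h2, h3, h5⟩

lemma exists_cross_ne_zero {v : Fin 3 → ℂ} (h : v ≠ 0) : ∃ u : Fin 3 → ℂ, v ⨯₃ u ≠ 0 := by
  by_contra! h'
  have h0 := h' ![1, 0, 0]
  have h1 := h' ![0, 1, 0]
  simp [cross_apply] at h0 h1
  refine h (funext fun i => ?_)
  fin_cases i
  exacts [h1.2, h0.2, h0.1]

/-- Two independent vectors can be moved to the first two basis vectors. -/
lemma exists_matrix_mulVec_eq {v u : Fin 3 → ℂ} (h : v ⨯₃ u ≠ 0) :
    ∃ N N' : Matrix (Fin 3) (Fin 3) ℂ, N * N' = 1 ∧ N' * N = 1 ∧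
      N *ᵥ v = ![1, 0, 0] ∧ N *ᵥ u = ![0, 1, 0] := by
  obtain ⟨w, hw⟩ := exists_dotProduct_ne_zero h
  obtain ⟨V, V', h1, h2, h3, h4, -⟩ := exists_matrix_of_det_ne_zero v u w (by
    have : (Matrix.of ![v, u, w]).det = w ⬝ᵥ (v ⨯₃ u) := by
      simp [Matrix.det_fin_three, cross_apply, dotProduct, Fin.sum_univ_three]
      ring
    rwa [this])
  refine ⟨V', V, h2, h1, ?_, ?_⟩
  · have : v = V *ᵥ ![1, 0, 0] := funext fun i => by
      simp [mulVec, dotProduct, Fin.sum_univ_three, h3]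
    rw [this, mulVec_mulVec, h2, one_mulVec]
  · have : u = V *ᵥ ![0, 1, 0] := funext fun i => by
      simp [mulVec, dotProduct, Fin.sum_univ_three, h4]
    rw [this, mulVec_mulVec, h2, one_mulVec]

/-- Two dependent vectors can be moved to the first coordinate axis. -/
lemma exists_matrix_mulVec_eq_of_cross_eq_zero {v u : Fin 3 → ℂ} (h : v ⨯₃ u = 0) :
    ∃ (N N' : Matrix (Fin 3) (Fin 3) ℂ) (μ ν : ℂ), N * N' = 1 ∧ N' * N = 1 ∧
      N *ᵥ v = ![μ, 0, 0] ∧ N *ᵥ u = ![ν, 0, 0] := by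
  obtain ⟨m, hm, μ, ν, hμ, hν⟩ : ∃ m : Fin 3 → ℂ, m ≠ 0 ∧ ∃ μ ν : ℂ, v = μ • m ∧ u = ν • m := by
    by_cases hv : v = 0
    · by_cases hu : u = 0
      · exact ⟨![1, 0, 0], fun h => by simpa using congrFun h 0, 0, 0, by simp [hv], by simp [hu]⟩
      · exact ⟨u, hu, 0, 1, by simp [hv], by simp⟩
    · have := mt crossProduct_ne_zero_iff_linearIndependent.2 (not_not.2 h)
      rw [LinearIndependent.pair_iff' hv] at this
      push Not at this
      obtain ⟨ν, hν⟩ := this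
      exact ⟨v, hv, 1, ν, by simp, hν.symm⟩
  obtain ⟨w, hw⟩ := exists_cross_ne_zero hm
  obtain ⟨N, N', h1, h2, h3, -⟩ := exists_matrix_mulVec_eq hw
  refine ⟨N, N', μ, ν, h1, h2, ?_, ?_⟩
  · rw [hμ, mulVec_smul, h3]
    simp
  · rw [hν, mulVec_smul, h3]
    simp

end LinearAlgebra

/-- `S` is contained in a finite union of zero sets of nonzero polynomials of degree at most 2. -/
def QuadricCovered (S : Set (Fin 3 → ℂ)) : Prop :=
  ∃ T : Finset (MvPolynomial (Fin 3) ℂ), (∀ p ∈ T, p ≠ 0 ∧ p.totalDegree ≤ 2) ∧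
    ∀ a ∈ S, ∃ p ∈ T, MvPolynomial.eval a p = 0

namespace QuadricCovered

open MvPolynomial

lemma mono {S S' : Set (Fin 3 → ℂ)} (h : QuadricCovered S') (hS : S ⊆ S') :
    QuadricCovered S := by
  obtain ⟨T, h1, h2⟩ := h
  exact ⟨T, h1, fun a ha => h2 a (hS ha)⟩

lemma of_eq_zero (p : MvPolynomial (Fin 3) ℂ) (h0 : p ≠ 0) (h2 : p.totalDegree ≤ 2) :
    QuadricCovered {a | eval a p = 0} :=
  ⟨{p}, by simp [h0, h2], by simp⟩

lemma biUnion {ι : Type*} {I : Set ι} (hI : I.Finite) {S : ι → Set (Fin 3 → ℂ)}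
    (h : ∀ i ∈ I, QuadricCovered (S i)) : QuadricCovered (⋃ i ∈ I, S i) := by
  classical
  choose! T hT hT' using h
  refine ⟨hI.toFinset.biUnion T, ?_, ?_⟩
  · intro p hp
    simp only [Finset.mem_biUnion, Set.Finite.mem_toFinset] at hp
    obtain ⟨i, hi, hp⟩ := hp
    exact hT i hi p hp
  · intro a ha
    simp only [Set.mem_iUnion] at ha
    obtain ⟨i, hi, ha⟩ := ha
    obtain ⟨p, hp, hpa⟩ := hT' i hi a ha
    exact ⟨p, by simpa using ⟨i, hi, hp⟩, hpa⟩

lemma empty : QuadricCovered ∅ := ⟨∅, by simp, by simp⟩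

lemma union {S S' : Set (Fin 3 → ℂ)} (h : QuadricCovered S) (h' : QuadricCovered S') :
    QuadricCovered (S ∪ S') := by
  classical
  obtain ⟨T, h1, h2⟩ := h
  obtain ⟨T', h1', h2'⟩ := h'
  refine ⟨T ∪ T', ?_, ?_⟩
  · intro p hp
    rcases Finset.mem_union.1 hp with hp | hp
    exacts [h1 p hp, h1' p hp]
  · rintro a (ha | ha)
    · obtain ⟨p, hp, hp'⟩ := h2 a ha
      exact ⟨p, Finset.mem_union_left _ hp, hp'⟩
    · obtain ⟨p, hp, hp'⟩ := h2' a ha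
      exact ⟨p, Finset.mem_union_right _ hp, hp'⟩

lemma totalDegree_aeval_le (L : Fin 3 → MvPolynomial (Fin 3) ℂ)
    (hL : ∀ i, (L i).totalDegree ≤ 1) (p : MvPolynomial (Fin 3) ℂ) :
    (aeval L p).totalDegree ≤ p.totalDegree := by
  rw [aeval_def, eval₂_eq]
  refine totalDegree_finsetSum_le fun d hd => ?_
  refine (totalDegree_mul _ _).trans ?_
  rw [show algebraMap ℂ (MvPolynomial (Fin 3) ℂ) (coeff d p) = C (coeff d p) from rfl,
    totalDegree_C, zero_add]
  refine (totalDegree_finsetProd _ _).trans ?_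
  refine le_trans ?_ (le_totalDegree hd)
  rw [Finsupp.sum]
  refine Finset.sum_le_sum fun i _ => (totalDegree_pow _ _).trans ?_
  exact (Nat.mul_le_mul_left _ (hL i)).trans (by simp)

lemma comap (N M : Matrix (Fin 3) (Fin 3) ℂ) (hNM : N * M = 1)
    {S S' : Set (Fin 3 → ℂ)} (h : QuadricCovered S') (hS : ∀ a ∈ S, N.mulVec a ∈ S') :
    QuadricCovered S := by
  classical
  obtain ⟨T, h1, h2⟩ := h
  let L : Fin 3 → MvPolynomial (Fin 3) ℂ := fun i => ∑ j, C (N i j) * X j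
  have hL : ∀ i, (L i).totalDegree ≤ 1 := by
    intro i
    refine totalDegree_finsetSum_le fun j _ => (totalDegree_mul _ _).trans ?_
    simp
  have hev : ∀ p a, eval a (aeval L p) = eval (N.mulVec a) p := by
    intro p a
    have h1 : eval a (aeval L p) = aeval (fun i => eval a (L i)) p := by
      have := comp_aeval_apply (R := ℂ) (f := L) (aeval a : MvPolynomial (Fin 3) ℂ →ₐ[ℂ] ℂ) p
      simpa [aeval_eq_eval] using this
    rw [h1, aeval_eq_eval]
    congr 1
    congr 1
    funext i
    simp [L, Matrix.mulVec, dotProduct]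
  refine ⟨T.image (aeval L), ?_, ?_⟩
  · intro q hq
    obtain ⟨p, hp, rfl⟩ := Finset.mem_image.1 hq
    refine ⟨fun h0 => (h1 p hp).1 ?_, (totalDegree_aeval_le L hL p).trans (h1 p hp).2⟩
    refine MvPolynomial.funext fun x => ?_
    have := hev p (M.mulVec x)
    rw [h0, Matrix.mulVec_mulVec, hNM, Matrix.one_mulVec] at this
    simpa using this.symm
  · intro a ha
    obtain ⟨p, hp, hp0⟩ := h2 _ (hS a ha)
    exact ⟨_, Finset.mem_image_of_mem _ hp, by rw [hev, hp0]⟩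

lemma totalDegree_affine_le (n : Fin 3 → ℂ) (c : ℂ) :
    (∑ i, C (n i) * X i + C c : MvPolynomial (Fin 3) ℂ).totalDegree ≤ 1 := by
  refine (totalDegree_add _ _).trans (max_le ?_ (by simp))
  refine totalDegree_finsetSum_le fun j _ => (totalDegree_mul _ _).trans ?_
  simp

lemma plane (n : Fin 3 → ℂ) (c : ℂ) (hn : n ≠ 0) :
    QuadricCovered {a | n 0 * a 0 + n 1 * a 1 + n 2 * a 2 + c = 0} := by
  refine (of_eq_zero (∑ i, C (n i) * X i + C c) ?_
    ((totalDegree_affine_le n c).trans (by norm_num))).mono ?_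
  · intro h
    apply hn
    have hev : ∀ x : Fin 3 → ℂ, ∑ i, n i * x i + c = 0 := by
      intro x
      simpa using congrArg (eval x) h
    have hc : c = 0 := by simpa using hev 0
    funext i
    simpa [hc, Pi.single_apply] using hev (Pi.single i 1)
  · intro a ha
    simpa [Fin.sum_univ_three] using ha

/-- A product of an arbitrary line and a quadratically parametrized plane curve. -/
lemma curve (p₀ p₁ p₂ q₀ q₁ q₂ : ℂ) :
    QuadricCovered {a | ∃ s, a 1 = p₂ * s ^ 2 + p₁ * s + p₀ ∧ a 2 = q₂ * s ^ 2 + q₁ * s + q₀} := by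
  by_cases h2 : p₂ = 0 ∧ q₂ = 0
  · by_cases h1 : p₁ = 0 ∧ q₁ = 0
    · refine (plane ![0, 1, 0] (-p₀) (fun h => by simpa using congrFun h 1)).mono ?_
      rintro a ⟨s, ha, -⟩
      simp [ha, h1.1, h2.1]
    · refine (plane ![0, q₁, -p₁] (p₁ * q₀ - q₁ * p₀) (fun h => h1 ?_)).mono ?_
      · exact ⟨by simpa using congrFun h 2, by simpa using congrFun h 1⟩
      · rintro a ⟨s, ha, hb⟩
        simp [ha, hb, h2.1, h2.2]
        ring
  · let D := p₂ * q₁ - q₂ * p₁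
    let A : MvPolynomial (Fin 3) ℂ := ∑ i, C (![0, -q₂, p₂] i) * X i + C (q₂ * p₀ - p₂ * q₀)
    let B : MvPolynomial (Fin 3) ℂ :=
      ∑ i, C (![0, -D * q₁, D * p₁] i) * X i + C (D * (q₁ * p₀ - p₁ * q₀))
    have hA : ∀ a, eval a A = p₂ * (a 2 - q₀) - q₂ * (a 1 - p₀) := by
      intro a
      simp [A, Fin.sum_univ_three]
      ring
    have hB : ∀ a, eval a B = D * (p₁ * (a 2 - q₀) - q₁ * (a 1 - p₀)) := by
      intro a
      simp [B, Fin.sum_univ_three]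
      ring
    refine (of_eq_zero (A ^ 2 + B) ?_ ?_).mono ?_
    · intro h
      have hev : ∀ a, (eval a A) ^ 2 + eval a B = 0 := by
        intro a
        simpa using congrArg (eval a) h
      apply h2
      constructor
      · have e1 := hev ![0, p₀, q₀ + 1]
        have e2 := hev ![0, p₀, q₀ - 1]
        simp [hA, hB] at e1 e2
        have : p₂ ^ 2 = 0 := by linear_combination (e1 + e2) / 2
        simpa using this
      · have e1 := hev ![0, p₀ + 1, q₀]
        have e2 := hev ![0, p₀ - 1, q₀]
        simp [hA, hB] at e1 e2
        have : q₂ ^ 2 = 0 := by linear_combination (e1 + e2) / 2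
        simpa using this
    · refine (totalDegree_add _ _).trans (max_le ?_ ?_)
      · exact (totalDegree_pow _ _).trans
          (Nat.mul_le_mul_left 2 (totalDegree_affine_le _ _))
      · exact (totalDegree_affine_le _ _).trans (by norm_num)
    · rintro a ⟨s, ha, hb⟩
      simp only [Set.mem_ofPred_eq, map_add, map_pow, hA, hB, ha, hb, D]
      ring

/-- The plane given by prescribing the last coordinate. -/
lemma last_eq (c : ℂ) : QuadricCovered {a | a 2 = c} := by
  refine (plane ![0, 0, 1] (-c) (fun h => by simpa using congrFun h 2)).mono ?_
  intro a ha
  simp only [Set.mem_ofPred_eq] at ha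
  simp [ha]

/-- An irreducible hypersurface in a covered set has degree at most 2. -/
lemma totalDegree_le {S : Set (Fin 3 → ℂ)} (h : QuadricCovered S)
    {Q : MvPolynomial (Fin 3) ℂ} (hQ : Irreducible Q) (hS : {x | eval x Q = 0} ⊆ S) :
    Q.totalDegree ≤ 2 := by
  obtain ⟨T, h1, h2⟩ := h
  have hprime : Prime Q := hQ.prime
  have hI : (Ideal.span {Q}).IsPrime := (Ideal.span_singleton_prime hQ.ne_zero).2 hprime
  have hmem : (∏ p ∈ T, p) ∈ Ideal.span {Q} := by
    rw [← IsPrime.vanishingIdeal_zeroLocus (K := ℂ) (Ideal.span {Q}), mem_vanishingIdeal_iff]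
    intro x hx
    have hx0 : eval x Q = 0 := by
      simpa [aeval_eq_eval] using (mem_zeroLocus_iff.1 hx) Q (Ideal.mem_span_singleton_self Q)
    obtain ⟨p, hp, hp0⟩ := h2 x (hS hx0)
    rw [map_prod]
    exact Finset.prod_eq_zero hp (by simpa [aeval_eq_eval] using hp0)
  rw [Ideal.mem_span_singleton] at hmem
  obtain ⟨p, hp, hdvd⟩ := hprime.exists_mem_finset_dvd hmem
  exact (totalDegree_le_of_dvd_of_isDomain hdvd (h1 p hp).1).trans (h1 p hp).2

end QuadricCovered

namespace QuadricCovered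

variable {K : Type} [LimitField K]

local notation "κ" => LimitField.cst (K := K)

/-- Binary quadratic polynomials. -/
def bq (g : Fin 6 → ℂ) (Y Z : K) : K :=
  κ (g 0) * Y ^ 2 + κ (g 1) * Y * Z + κ (g 2) * Z ^ 2 + κ (g 3) * Y + κ (g 4) * Z
    + κ (g 5)

/-- Binary cubic polynomials. -/
def cub (k : Fin 10 → ℂ) (Y Z : K) : K :=
  κ (k 0) * Y ^ 3 + κ (k 1) * Y ^ 2 * Z + κ (k 2) * Y * Z ^ 2 + κ (k 3) * Z ^ 3
    + κ (k 4) * Y ^ 2 + κ (k 5) * Y * Z + κ (k 6) * Z ^ 2 + κ (k 7) * Y + κ (k 8) * Z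
    + κ (k 9)

lemma lim_cst_zero {c : ℂ} (h : Lim (κ c) 0) : c = 0 := lim_cst_eq h

lemma plane_of (n₀ n₁ n₂ c : ℂ) (hn : ¬ (n₀ = 0 ∧ n₁ = 0 ∧ n₂ = 0)) {S : Set (Fin 3 → ℂ)}
    (hS : ∀ a ∈ S, n₀ * a 0 + n₁ * a 1 + n₂ * a 2 + c = 0) : QuadricCovered S := by
  refine (plane ![n₀, n₁, n₂] c fun h => hn ?_).mono hS
  exact ⟨congrFun h 0, congrFun h 1, congrFun h 2⟩

/-- Asymptotics along a branch of a hyperbola at which the first coordinate is infinite. -/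
lemma hyperbola_branch (α β γ δ : ℂ) (k : Fin 10 → ℂ) :
    QuadricCovered {a | ∃ T u w : K, Infinite' u ∧ Lim T (a 1) ∧ Lim (u * w + κ δ) (a 2) ∧
      Lim (T * (κ α * u + κ β * w + κ γ) + cub k u w) (a 0)} := by
  have key : ∀ (a : Fin 3 → ℂ) (T u w : K), Infinite' u → Lim T (a 1) →
      Lim (u * w + κ δ) (a 2) →
      Lim (T * (κ α * u + κ β * w + κ γ) + cub k u w) (a 0) →
      k 0 = 0 ∧ k 4 = 0 ∧ α * a 1 + k 1 * (a 2 - δ) + k 7 = 0 ∧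
      (α = 0 → k 1 = 0 → a 0 = γ * a 1 + k 5 * (a 2 - δ) + k 9) := by
    intro a T u w hu hT hA hF
    obtain ⟨A, hAdef⟩ : ∃ A, A = u * w := ⟨_, rfl⟩
    have hA' : Lim A (a 2 - δ) := by
      simpa [hAdef] using lim_sub hA (lim_cst (K := K) δ)
    have hw : Lim w 0 := by
      have := hu.lim_div hA'
      rwa [hAdef, mul_comm u w, mul_assoc, mul_inv_cancel₀ hu.1, mul_one] at this
    have ht0 : Lim (T * (κ β * w + κ γ) + κ (k 2) * A * w + κ (k 3) * w ^ 3
        + κ (k 5) * A + κ (k 6) * w ^ 2 + κ (k 8) * w + κ (k 9))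
        (a 1 * (β * 0 + γ) + k 2 * (a 2 - δ) * 0 + k 3 * 0 ^ 3 + k 5 * (a 2 - δ)
          + k 6 * 0 ^ 2 + k 8 * 0 + k 9) := by
      apply_rules [lim_add, lim_mul, lim_cst, lim_pow]
    have ht1 : Lim (κ α * T + κ (k 1) * A + κ (k 7)) (α * a 1 + k 1 * (a 2 - δ) + k 7) := by
      apply_rules [lim_add, lim_mul, lim_cst, lim_pow]
    have hS1 : Lim (κ α * T + κ (k 1) * A + κ (k 7) + u * (κ (k 4) + u * κ (k 0))) 0 := by
      refine peel hu hF ht0 ?_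
      simp only [cub, hAdef]
      ring
    have hS2 := peel hu hS1 ht1 rfl
    have hk0 := lim_cst_zero (peel hu hS2 (lim_cst (k 4)) rfl)
    rw [hk0, map_zero, mul_zero, add_zero] at hS2
    have hk4 := lim_cst_zero hS2
    rw [hk0, hk4, map_zero, mul_zero, add_zero, mul_zero, add_zero] at hS1
    have h1 := lim_unique hS1 ht1
    refine ⟨hk0, hk4, h1.symm, fun hα hk1 => ?_⟩
    have hk7 : k 7 = 0 := by simpa [hα, hk1] using h1.symm
    have hF' : T * (κ α * u + κ β * w + κ γ) + cub k u w =
        T * (κ β * w + κ γ) + κ (k 2) * A * w + κ (k 3) * w ^ 3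
        + κ (k 5) * A + κ (k 6) * w ^ 2 + κ (k 8) * w + κ (k 9) := by
      simp only [cub, hAdef, hα, hk1, hk7, hk0, hk4, map_zero]
      ring
    rw [hF'] at hF
    rw [lim_unique hF ht0]
    ring
  by_cases h : α = 0 ∧ k 1 = 0
  · refine plane_of 1 (-γ) (-k 5) (k 5 * δ - k 9) (by simp) ?_
    rintro a ⟨T, u, w, hu, hT, hA, hF⟩
    linear_combination (key a T u w hu hT hA hF).2.2.2 h.1 h.2
  · refine plane_of 0 α (k 1) (k 7 - k 1 * δ) (by simpa using h) ?_
    rintro a ⟨T, u, w, hu, hT, hA, hF⟩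
    linear_combination (key a T u w hu hT hA hF).2.2.1

lemma hyperbola (α β γ δ : ℂ) (k : Fin 10 → ℂ) :
    QuadricCovered {a | ∃ T u w : K, ¬ (Fin' u ∧ Fin' w) ∧ Lim T (a 1) ∧
      Lim (u * w + κ δ) (a 2) ∧
      Lim (T * (κ α * u + κ β * w + κ γ) + cub k u w) (a 0)} := by
  refine ((hyperbola_branch (K := K) α β γ δ k).union (hyperbola_branch (K := K) β α γ δ
    ![k 3, k 2, k 1, k 0, k 6, k 5, k 4, k 8, k 7, k 9])).mono ?_
  rintro a ⟨T, u, w, hi, hT, hA, hF⟩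
  by_cases hu : Fin' u
  · refine Or.inr ⟨T, w, u, not_fin.1 fun hw => hi ⟨hu, hw⟩, hT, by rwa [mul_comm], ?_⟩
    convert hF using 1
    simp [cub]
    ring
  · exact Or.inl ⟨T, u, w, not_fin.1 hu, hT, hA, hF⟩

/-- A nonconstant polynomial of degree at most two takes infinite values at infinite elements. -/
lemma fin_of_lim_quadratic {r t d : ℂ} (h : ¬ (r = 0 ∧ t = 0)) {Z : K} {b : ℂ}
    (hZ : Lim (κ r * Z ^ 2 + κ t * Z + κ d) b) : Fin' Z := by
  by_contra hZ'
  rw [not_fin] at hZ'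
  have h1 : Lim (κ t + Z * κ r) 0 := peel hZ' hZ (lim_cst d) (by ring)
  have hr := lim_cst_zero (peel hZ' h1 (lim_cst t) rfl)
  rw [hr, map_zero, mul_zero, add_zero] at h1
  exact h ⟨hr, lim_cst_zero h1⟩

lemma parallel_lines (r t d : ℂ) (h : ¬ (r = 0 ∧ t = 0)) (k : Fin 10 → ℂ) :
    QuadricCovered {a | ∃ T Y Z : K, ¬ (Fin' Y ∧ Fin' Z) ∧ Lim T (a 1) ∧
      Lim (κ r * Z ^ 2 + κ t * Z + κ d) (a 2) ∧
      Lim (T * Y + cub k Y Z) (a 0)} := by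
  have key : ∀ (a : Fin 3 → ℂ) (T Y Z : K), ¬ (Fin' Y ∧ Fin' Z) → Lim T (a 1) →
      Lim (κ r * Z ^ 2 + κ t * Z + κ d) (a 2) → Lim (T * Y + cub k Y Z) (a 0) →
      ∃ z, a 2 = r * z ^ 2 + t * z + d ∧ k 1 * z + k 4 = 0 ∧
        (k 1 = 0 → a 1 = -k 2 * z ^ 2 + -k 5 * z + -k 7) := by
    intro a T Y Z hi hT hA hF
    obtain ⟨z, hz⟩ := fin_of_lim_quadratic h hA
    have hY : Infinite' Y := not_fin.1 fun hY => hi ⟨hY, z, hz⟩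
    have ht0 : Lim (κ (k 3) * Z ^ 3 + κ (k 6) * Z ^ 2 + κ (k 8) * Z + κ (k 9))
      (k 3 * z ^ 3 + k 6 * z ^ 2 + k 8 * z + k 9) := by
      apply_rules [lim_add, lim_mul, lim_cst, lim_pow]
    have ht1 : Lim (T + κ (k 2) * Z ^ 2 + κ (k 5) * Z + κ (k 7))
      (a 1 + k 2 * z ^ 2 + k 5 * z + k 7) := by
      apply_rules [lim_add, lim_mul, lim_cst, lim_pow]
    have ht2 : Lim (κ (k 1) * Z + κ (k 4)) (k 1 * z + k 4) := by
      apply_rules [lim_add, lim_mul, lim_cst, lim_pow]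
    have hS1 : Lim (T + κ (k 2) * Z ^ 2 + κ (k 5) * Z + κ (k 7) +
        Y * (κ (k 1) * Z + κ (k 4) + Y * κ (k 0))) 0 := by
      refine peel hY hF ht0 ?_
      simp only [cub]
      ring
    have hS2 := peel hY hS1 ht1 rfl
    have hk0 := lim_cst_zero (peel hY hS2 ht2 rfl)
    rw [hk0, map_zero, mul_zero, add_zero] at hS2 hS1
    have h2 := lim_unique ht2 hS2
    refine ⟨z, ?_, h2, fun hk1 => ?_⟩
    · refine lim_unique hA ?_
      apply_rules [lim_add, lim_mul, lim_cst, lim_pow]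
    · have hk4 : k 4 = 0 := by simpa [hk1] using h2
      rw [hk1, hk4, map_zero, zero_mul, add_zero, mul_zero, add_zero] at hS1
      linear_combination lim_unique ht1 hS1
  by_cases hk1 : k 1 = 0
  · refine (curve (-k 7) (-k 5) (-k 2) d t r).mono ?_
    rintro a ⟨T, Y, Z, hi, hT, hA, hF⟩
    obtain ⟨z, h2, -, h1⟩ := key a T Y Z hi hT hA hF
    exact ⟨z, h1 hk1, h2⟩
  · refine (last_eq (r * (-k 4 / k 1) ^ 2 + t * (-k 4 / k 1) + d)).mono ?_
    rintro a ⟨T, Y, Z, hi, hT, hA, hF⟩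
    obtain ⟨z, h2, h1, -⟩ := key a T Y Z hi hT hA hF
    have : z = -k 4 / k 1 := by
      rw [eq_div_iff hk1]
      linear_combination h1
    rw [← this]
    exact h2

lemma parabola_first (ρ σ δ : ℂ) (hρ : ρ ≠ 0) (hσ : σ ≠ 0) (k : Fin 10 → ℂ) :
    QuadricCovered {a | ∃ T Y Z : K, ¬ (Fin' Y ∧ Fin' Z) ∧ Lim T (a 1) ∧
      Lim (κ σ * (Y - κ ρ * Z ^ 2) + κ δ) (a 2) ∧
      Lim (T * Y + cub k Y Z) (a 0)} := by
  refine plane_of 0 ρ ((k 2 + 2 * k 4 * ρ) / σ)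
    (k 6 + k 7 * ρ - (k 2 + 2 * k 4 * ρ) / σ * δ) (by simp [hρ]) ?_
  rintro a ⟨T, Y, Z, hi, hT, hA, hF⟩
  obtain ⟨A, hAdef⟩ : ∃ A, A = Y - κ ρ * Z ^ 2 := ⟨_, rfl⟩
  have hY : Y = A + κ ρ * Z ^ 2 := by rw [hAdef]; ring
  have hσ' : κ σ ≠ 0 := by simpa using hσ
  have hA' : Lim A ((a 2 - δ) * σ⁻¹) := by
    have := lim_mul (lim_sub hA (lim_cst (K := K) δ)) (lim_cst σ⁻¹)
    rw [← hAdef, map_inv₀, add_sub_cancel_right, mul_comm (κ σ) A, mul_assoc,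
      mul_inv_cancel₀ hσ', mul_one] at this
    exact this
  set b := (a 2 - δ) * σ⁻¹ with hb
  have hZ : Infinite' Z := by
    refine not_fin.1 fun ⟨z, hz⟩ => hi ⟨?_, z, hz⟩
    rw [hY]
    exact ⟨_, lim_add hA' (lim_mul (lim_cst ρ) (lim_pow hz 2))⟩
  have ht0 : Lim (T * A + κ (k 0) * A ^ 3 + κ (k 4) * A ^ 2 + κ (k 7) * A + κ (k 9))
      (a 1 * b + k 0 * b ^ 3 + k 4 * b ^ 2 + k 7 * b + k 9) := by
    apply_rules [lim_add, lim_mul, lim_cst, lim_pow]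
  have ht1 : Lim (κ (k 1) * A ^ 2 + κ (k 5) * A + κ (k 8))
      (k 1 * b ^ 2 + k 5 * b + k 8) := by
    apply_rules [lim_add, lim_mul, lim_cst, lim_pow]
  have ht2 : Lim (T * κ ρ + κ (k 2 + 2 * k 4 * ρ) * A + κ (k 6 + k 7 * ρ)
        + κ (3 * k 0 * ρ) * A ^ 2)
      (a 1 * ρ + (k 2 + 2 * k 4 * ρ) * b + (k 6 + k 7 * ρ) + 3 * k 0 * ρ * b ^ 2) := by
    apply_rules [lim_add, lim_mul, lim_cst, lim_pow]
  have ht3 : Lim (κ (k 3 + k 5 * ρ) + κ (2 * k 1 * ρ) * A)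
      (k 3 + k 5 * ρ + 2 * k 1 * ρ * b) := by
    apply_rules [lim_add, lim_mul, lim_cst, lim_pow]
  have ht4 : Lim (κ (k 2 * ρ + k 4 * ρ ^ 2) + κ (3 * k 0 * ρ ^ 2) * A)
      (k 2 * ρ + k 4 * ρ ^ 2 + 3 * k 0 * ρ ^ 2 * b) := by
    apply_rules [lim_add, lim_mul, lim_cst, lim_pow]
  have hS1 : Lim (κ (k 1) * A ^ 2 + κ (k 5) * A + κ (k 8) + Z *
      (T * κ ρ + κ (k 2 + 2 * k 4 * ρ) * A + κ (k 6 + k 7 * ρ)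
        + κ (3 * k 0 * ρ) * A ^ 2 + Z *
      (κ (k 3 + k 5 * ρ) + κ (2 * k 1 * ρ) * A + Z *
      (κ (k 2 * ρ + k 4 * ρ ^ 2) + κ (3 * k 0 * ρ ^ 2) * A + Z *
      (κ (k 1 * ρ ^ 2) + Z * κ (k 0 * ρ ^ 3)))))) 0 := by
    refine peel hZ hF ht0 ?_
    simp only [cub, hY, map_add, map_mul, map_pow, map_ofNat]
    ring
  have hS2 := peel hZ hS1 ht1 rfl
  have hS3 := peel hZ hS2 ht2 rfl
  have hS4 := peel hZ hS3 ht3 rfl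
  have hS5 := peel hZ hS4 ht4 rfl
  have hk0' := lim_cst_zero (peel hZ hS5 (lim_cst _) rfl)
  have hk0 : k 0 = 0 := by simpa [hρ] using hk0'
  rw [hk0', map_zero, mul_zero, add_zero] at hS5
  have hk1' := lim_cst_zero hS5
  have hk1 : k 1 = 0 := by simpa [hρ] using hk1'
  simp only [hk0, hk1, zero_mul, mul_zero, map_zero, add_zero] at hS4
  have h4 := lim_cst_zero hS4
  simp only [hk0, hk1, h4, zero_mul, mul_zero, map_zero, add_zero] at hS3
  have h3 := lim_cst_zero hS3
  simp only [hk0, hk1, h4, h3, zero_mul, mul_zero, map_zero, add_zero] at hS2 ht2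
  have := lim_unique ht2 hS2
  rw [hb] at this
  linear_combination this

lemma parabola_second (ρ σ δ : ℂ) (hρ : ρ ≠ 0) (hσ : σ ≠ 0) (k : Fin 10 → ℂ) :
    QuadricCovered {a | ∃ T Y Z : K, ¬ (Fin' Y ∧ Fin' Z) ∧ Lim T (a 1) ∧
      Lim (κ σ * (Z - κ ρ * Y ^ 2) + κ δ) (a 2) ∧
      Lim (T * Y + cub k Y Z) (a 0)} := by
  have key : ∀ (a : Fin 3 → ℂ) (T Y Z : K), ¬ (Fin' Y ∧ Fin' Z) → Lim T (a 1) →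
      Lim (κ σ * (Z - κ ρ * Y ^ 2) + κ δ) (a 2) → Lim (T * Y + cub k Y Z) (a 0) →
      k 4 + k 8 * ρ + k 6 * ρ * ((a 2 - δ) * σ⁻¹) = 0 ∧
        (k 6 = 0 → a 1 + k 5 * ((a 2 - δ) * σ⁻¹) + k 7 = 0) := by
    intro a T Y Z hi hT hA hF
    obtain ⟨A, hAdef⟩ : ∃ A, A = Z - κ ρ * Y ^ 2 := ⟨_, rfl⟩
    have hZ : Z = A + κ ρ * Y ^ 2 := by rw [hAdef]; ring
    have hσ' : κ σ ≠ 0 := by simpa using hσ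
    have hA' : Lim A ((a 2 - δ) * σ⁻¹) := by
      have := lim_mul (lim_sub hA (lim_cst (K := K) δ)) (lim_cst σ⁻¹)
      rw [← hAdef, map_inv₀, add_sub_cancel_right, mul_comm (κ σ) A, mul_assoc,
        mul_inv_cancel₀ hσ', mul_one] at this
      exact this
    set b := (a 2 - δ) * σ⁻¹ with hb
    have hY : Infinite' Y := by
      refine not_fin.1 fun ⟨y, hy⟩ => hi ⟨⟨y, hy⟩, ?_⟩
      rw [hZ]
      exact ⟨_, lim_add hA' (lim_mul (lim_cst ρ) (lim_pow hy 2))⟩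
    have ht0 : Lim (κ (k 3) * A ^ 3 + κ (k 6) * A ^ 2 + κ (k 8) * A + κ (k 9))
        (k 3 * b ^ 3 + k 6 * b ^ 2 + k 8 * b + k 9) := by
      apply_rules [lim_add, lim_mul, lim_cst, lim_pow]
    have ht1 : Lim (T + κ (k 2) * A ^ 2 + κ (k 5) * A + κ (k 7))
        (a 1 + k 2 * b ^ 2 + k 5 * b + k 7) := by
      apply_rules [lim_add, lim_mul, lim_cst, lim_pow]
    have ht2 : Lim (κ (k 4 + k 8 * ρ) + κ (k 1 + 2 * k 6 * ρ) * A
          + κ (3 * k 3 * ρ) * A ^ 2)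
        (k 4 + k 8 * ρ + (k 1 + 2 * k 6 * ρ) * b + 3 * k 3 * ρ * b ^ 2) := by
      apply_rules [lim_add, lim_mul, lim_cst, lim_pow]
    have ht3 : Lim (κ (k 0 + k 5 * ρ) + κ (2 * k 2 * ρ) * A)
        (k 0 + k 5 * ρ + 2 * k 2 * ρ * b) := by
      apply_rules [lim_add, lim_mul, lim_cst, lim_pow]
    have ht4 : Lim (κ (k 1 * ρ + k 6 * ρ ^ 2) + κ (3 * k 3 * ρ ^ 2) * A)
        (k 1 * ρ + k 6 * ρ ^ 2 + 3 * k 3 * ρ ^ 2 * b) := by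
      apply_rules [lim_add, lim_mul, lim_cst, lim_pow]
    have hS1 : Lim (T + κ (k 2) * A ^ 2 + κ (k 5) * A + κ (k 7) + Y *
        (κ (k 4 + k 8 * ρ) + κ (k 1 + 2 * k 6 * ρ) * A + κ (3 * k 3 * ρ) * A ^ 2 + Y *
        (κ (k 0 + k 5 * ρ) + κ (2 * k 2 * ρ) * A + Y *
        (κ (k 1 * ρ + k 6 * ρ ^ 2) + κ (3 * k 3 * ρ ^ 2) * A + Y *
        (κ (k 2 * ρ ^ 2) + Y * κ (k 3 * ρ ^ 3)))))) 0 := by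
      refine peel hY hF ht0 ?_
      simp only [cub, hZ, map_add, map_mul, map_pow, map_ofNat]
      ring
    have hS2 := peel hY hS1 ht1 rfl
    have hS3 := peel hY hS2 ht2 rfl
    have hS4 := peel hY hS3 ht3 rfl
    have hS5 := peel hY hS4 ht4 rfl
    have hk3' := lim_cst_zero (peel hY hS5 (lim_cst _) rfl)
    have hk3 : k 3 = 0 := by simpa [hρ] using hk3'
    rw [hk3', map_zero, mul_zero, add_zero] at hS5
    have hk2' := lim_cst_zero hS5
    have hk2 : k 2 = 0 := by simpa [hρ] using hk2'
    simp only [hk3, hk2, zero_mul, mul_zero, map_zero, add_zero] at hS4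
    have h4 := lim_cst_zero hS4
    have hk1 : k 1 = - k 6 * ρ := by
      have : (k 1 + k 6 * ρ) * ρ = 0 := by linear_combination h4
      linear_combination (mul_eq_zero.1 this).resolve_right hρ
    simp only [hk3, hk2, h4, zero_mul, mul_zero, map_zero, add_zero] at hS3
    have h3 := lim_cst_zero hS3
    simp only [hk3, hk2, h4, h3, zero_mul, mul_zero, map_zero, add_zero] at hS2 ht2
    have h2 := lim_unique ht2 hS2
    rw [hk1] at h2
    refine ⟨by linear_combination h2, fun hk6 => ?_⟩
    have hk48 : k 4 + k 8 * ρ = 0 := by simpa [hk6] using h2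
    simp only [hk3, hk2, h3, hk1, hk6, hk48, zero_mul, mul_zero, map_zero, add_zero,
      neg_zero] at hS1 ht1
    exact lim_unique ht1 hS1
  by_cases hk6 : k 6 = 0
  · refine plane_of 0 1 (k 5 * σ⁻¹) (k 7 - k 5 * δ * σ⁻¹) (by simp) ?_
    rintro a ⟨T, Y, Z, hi, hT, hA, hF⟩
    linear_combination (key a T Y Z hi hT hA hF).2 hk6
  · refine plane_of 0 0 (k 6 * ρ * σ⁻¹) (k 4 + k 8 * ρ - k 6 * ρ * σ⁻¹ * δ)
      (by simp [hk6, hρ, hσ]) ?_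
    rintro a ⟨T, Y, Z, hi, hT, hA, hF⟩
    linear_combination (key a T Y Z hi hT hA hF).1

lemma finite_roots {A B C : ℂ} (h : ¬ (A = 0 ∧ B = 0 ∧ C = 0)) :
    {y : ℂ | A * y ^ 2 + B * y + C = 0}.Finite := by
  open Polynomial in
  refine Set.Finite.subset (Polynomial.finite_setOfPred_isRoot
    (p := Polynomial.C A * X ^ 2 + Polynomial.C B * X + Polynomial.C C) ?_) ?_
  · intro h0
    refine h ⟨?_, ?_, ?_⟩
    · simpa using congrArg (fun p => p.coeff 2) h0
    · simpa using congrArg (fun p => p.coeff 1) h0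
    · simpa using congrArg (fun p => p.coeff 0) h0
  · intro y hy
    simpa [Polynomial.IsRoot] using hy

lemma vertical_lines (p s d : ℂ) (h : ¬ (p = 0 ∧ s = 0)) (k : Fin 10 → ℂ)
    (hk : ¬ (k 1 = 0 ∧ k 2 = 0 ∧ k 5 = 0 ∧ k 6 = 0 ∧ k 8 = 0)) :
    QuadricCovered {a | ∃ T Y Z : K, ¬ (Fin' Y ∧ Fin' Z) ∧ Lim T (a 1) ∧
      Lim (κ p * Y ^ 2 + κ s * Y + κ d) (a 2) ∧
      Lim (T * Y + cub k Y Z) (a 0)} := by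
  have key : ∀ (a : Fin 3 → ℂ) (T Y Z : K), ¬ (Fin' Y ∧ Fin' Z) → Lim T (a 1) →
      Lim (κ p * Y ^ 2 + κ s * Y + κ d) (a 2) → Lim (T * Y + cub k Y Z) (a 0) →
      ∃ y, a 2 = p * y ^ 2 + s * y + d ∧ k 2 * y + k 6 = 0 ∧
        (k 2 = 0 → k 1 * y ^ 2 + k 5 * y + k 8 = 0) := by
    intro a T Y Z hi hT hA hF
    obtain ⟨y, hy⟩ := fin_of_lim_quadratic h hA
    have hZ : Infinite' Z := not_fin.1 fun hZ => hi ⟨⟨y, hy⟩, hZ⟩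
    have ht0 : Lim (T * Y + κ (k 0) * Y ^ 3 + κ (k 4) * Y ^ 2 + κ (k 7) * Y + κ (k 9))
      (a 1 * y + k 0 * y ^ 3 + k 4 * y ^ 2 + k 7 * y + k 9) := by
      apply_rules [lim_add, lim_mul, lim_cst, lim_pow]
    have ht1 : Lim (κ (k 1) * Y ^ 2 + κ (k 5) * Y + κ (k 8))
      (k 1 * y ^ 2 + k 5 * y + k 8) := by
      apply_rules [lim_add, lim_mul, lim_cst, lim_pow]
    have ht2 : Lim (κ (k 2) * Y + κ (k 6)) (k 2 * y + k 6) := by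
      apply_rules [lim_add, lim_mul, lim_cst, lim_pow]
    have hS1 : Lim (κ (k 1) * Y ^ 2 + κ (k 5) * Y + κ (k 8) +
        Z * (κ (k 2) * Y + κ (k 6) + Z * κ (k 3))) 0 := by
      refine peel hZ hF ht0 ?_
      simp only [cub]
      ring
    have hS2 := peel hZ hS1 ht1 rfl
    have hk3 := lim_cst_zero (peel hZ hS2 ht2 rfl)
    rw [hk3, map_zero, mul_zero, add_zero] at hS2 hS1
    have h2 := lim_unique ht2 hS2
    refine ⟨y, ?_, h2, fun hk2 => ?_⟩
    · refine lim_unique hA ?_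
      apply_rules [lim_add, lim_mul, lim_cst, lim_pow]
    · have hk6 : k 6 = 0 := by simpa [hk2] using h2
      rw [hk2, hk6, map_zero, zero_mul, add_zero, mul_zero, add_zero] at hS1
      exact lim_unique ht1 hS1
  by_cases hk2 : k 2 = 0
  · by_cases hk' : k 1 = 0 ∧ k 5 = 0 ∧ k 8 = 0
    · refine empty.mono ?_
      rintro a ⟨T, Y, Z, hi, hT, hA, hF⟩
      obtain ⟨y, -, h2, -⟩ := key a T Y Z hi hT hA hF
      exact hk ⟨hk'.1, hk2, hk'.2.1, by simpa [hk2] using h2, hk'.2.2⟩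
    · refine (biUnion (finite_roots hk') fun y _ => last_eq (p * y ^ 2 + s * y + d)).mono ?_
      rintro a ⟨T, Y, Z, hi, hT, hA, hF⟩
      obtain ⟨y, h2, -, h1⟩ := key a T Y Z hi hT hA hF
      exact Set.mem_biUnion (show y ∈ {y : ℂ | _} from h1 hk2) h2
  · refine (last_eq (p * (-k 6 / k 2) ^ 2 + s * (-k 6 / k 2) + d)).mono ?_
    rintro a ⟨T, Y, Z, hi, hT, hA, hF⟩
    obtain ⟨y, h2, h1, -⟩ := key a T Y Z hi hT hA hF
    have : y = -k 6 / k 2 := by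
      rw [eq_div_iff hk2]
      linear_combination h1
    rw [← this]
    exact h2

lemma exists_cub_add (k l : Fin 10 → ℂ) :
    ∃ m : Fin 10 → ℂ, ∀ U W : K, cub m U W = cub k U W + cub l U W :=
  ⟨fun i => k i + l i, fun U W => by simp only [cub, map_add]; ring⟩

lemma exists_cub_mul (a b c a' b' c' a'' b'' c'' e : ℂ) :
    ∃ m : Fin 10 → ℂ, ∀ U W : K, cub m U W =
      κ e * (κ a * U + κ b * W + κ c) * (κ a' * U + κ b' * W + κ c') *
        (κ a'' * U + κ b'' * W + κ c'') := by
  refine ⟨![e * (a * a' * a''),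
    e * (a * a' * b'' + a * b' * a'' + b * a' * a''),
    e * (a * b' * b'' + b * a' * b'' + b * b' * a''),
    e * (b * b' * b''),
    e * (a * a' * c'' + a * c' * a'' + c * a' * a''),
    e * (a * b' * c'' + a * c' * b'' + b * a' * c'' + b * c' * a'' + c * a' * b'' + c * b' * a''),
    e * (b * b' * c'' + b * c' * b'' + c * b' * b''),
    e * (a * c' * c'' + c * a' * c'' + c * c' * a''),
    e * (b * c' * c'' + c * b' * c'' + c * c' * b''),
    e * (c * c' * c'')], fun U W => ?_⟩
  simp [cub]
  ring

lemma exists_cub_comp (k : Fin 10 → ℂ) (a b c a' b' c' : ℂ) :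
    ∃ m : Fin 10 → ℂ, ∀ U W : K, cub m U W =
      cub k (κ a * U + κ b * W + κ c) (κ a' * U + κ b' * W + κ c') := by
  obtain ⟨m0, h0⟩ := exists_cub_mul (K := K) a b c a b c a b c (k 0)
  obtain ⟨m1, h1⟩ := exists_cub_mul (K := K) a b c a b c a' b' c' (k 1)
  obtain ⟨m2, h2⟩ := exists_cub_mul (K := K) a b c a' b' c' a' b' c' (k 2)
  obtain ⟨m3, h3⟩ := exists_cub_mul (K := K) a' b' c' a' b' c' a' b' c' (k 3)
  obtain ⟨m4, h4⟩ := exists_cub_mul (K := K) a b c a b c 0 0 1 (k 4)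
  obtain ⟨m5, h5⟩ := exists_cub_mul (K := K) a b c a' b' c' 0 0 1 (k 5)
  obtain ⟨m6, h6⟩ := exists_cub_mul (K := K) a' b' c' a' b' c' 0 0 1 (k 6)
  obtain ⟨m7, h7⟩ := exists_cub_mul (K := K) a b c 0 0 1 0 0 1 (k 7)
  obtain ⟨m8, h8⟩ := exists_cub_mul (K := K) a' b' c' 0 0 1 0 0 1 (k 8)
  obtain ⟨m9, h9⟩ := exists_cub_mul (K := K) 0 0 1 0 0 1 0 0 1 (k 9)
  obtain ⟨n1, e1⟩ := exists_cub_add (K := K) m0 m1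
  obtain ⟨n2, e2⟩ := exists_cub_add (K := K) n1 m2
  obtain ⟨n3, e3⟩ := exists_cub_add (K := K) n2 m3
  obtain ⟨n4, e4⟩ := exists_cub_add (K := K) n3 m4
  obtain ⟨n5, e5⟩ := exists_cub_add (K := K) n4 m5
  obtain ⟨n6, e6⟩ := exists_cub_add (K := K) n5 m6
  obtain ⟨n7, e7⟩ := exists_cub_add (K := K) n6 m7
  obtain ⟨n8, e8⟩ := exists_cub_add (K := K) n7 m8
  obtain ⟨n9, e9⟩ := exists_cub_add (K := K) n8 m9
  refine ⟨n9, fun U W => ?_⟩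
  rw [e9, e8, e7, e6, e5, e4, e3, e2, e1, h0, h1, h2, h3, h4, h5, h6, h7, h8, h9, cub]
  simp only [map_zero, map_one]
  ring

lemma fin_affine {U W : K} (hU : Fin' U) (hW : Fin' W) (a b c : ℂ) :
    Fin' (κ a * U + κ b * W + κ c) := by
  obtain ⟨u, hu⟩ := hU
  obtain ⟨w, hw⟩ := hW
  exact ⟨_, lim_add (lim_add (lim_mul (lim_cst a) hu) (lim_mul (lim_cst b) hw)) (lim_cst c)⟩

lemma hyperbola_comp (α β γ α' β' γ' δ : ℂ) (k : Fin 10 → ℂ) :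
    QuadricCovered {a | ∃ T u w Y Z : K, Y = κ α * u + κ β * w + κ γ ∧
      Z = κ α' * u + κ β' * w + κ γ' ∧ ¬ (Fin' Y ∧ Fin' Z) ∧ Lim T (a 1) ∧
      Lim (u * w + κ δ) (a 2) ∧ Lim (T * Y + cub k Y Z) (a 0)} := by
  obtain ⟨m, hm⟩ := exists_cub_comp (K := K) k α β γ α' β' γ'
  refine (hyperbola (K := K) α β γ δ m).mono ?_
  rintro a ⟨T, u, w, Y, Z, rfl, rfl, hi, hT, hA, hF⟩
  refine ⟨T, u, w, fun h => hi ⟨fin_affine h.1 h.2 _ _ _, fin_affine h.1 h.2 _ _ _⟩, hT, hA, ?_⟩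
  rwa [hm]

lemma conic_shear (ρ τ p r s d : ℂ) (hr : r ≠ 0) (k : Fin 10 → ℂ) :
    QuadricCovered {a | ∃ T Y Z : K, ¬ (Fin' Y ∧ Fin' Z) ∧ Lim T (a 1) ∧
      Lim (κ p * Y ^ 2 + κ r * (Z + κ ρ * Y + κ τ) ^ 2 + κ s * Y + κ d) (a 2) ∧
      Lim (T * Y + cub k Y Z) (a 0)} := by
  by_cases hp : p = 0
  · obtain ⟨m, hm⟩ := exists_cub_comp (K := K) k 1 0 0 (-ρ) 1 (-τ)
    have hm' : ∀ Y Z : K, cub m Y (Z + κ ρ * Y + κ τ) = cub k Y Z := fun Y Z => by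
      rw [hm]
      congr 1 <;> simp
      ring
    have hi' : ∀ Y Z : K, ¬ (Fin' Y ∧ Fin' Z) → ¬ (Fin' Y ∧ Fin' (Z + κ ρ * Y + κ τ)) := by
      rintro Y Z hi ⟨h1, h2⟩
      refine hi ⟨h1, ?_⟩
      convert fin_affine h1 h2 (-ρ) 1 (-τ) using 1
      simp
      ring
    by_cases hs : s = 0
    · refine (parallel_lines (K := K) r 0 d (by simp [hr]) m).mono ?_
      rintro a ⟨T, Y, Z, hi, hT, hA, hF⟩
      refine ⟨T, Y, Z + κ ρ * Y + κ τ, hi' Y Z hi, hT, ?_, by rwa [hm']⟩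
      simpa [hp, hs] using hA
    · refine (parabola_first (K := K) (-r / s) s d (by simp [hr, hs]) hs m).mono ?_
      rintro a ⟨T, Y, Z, hi, hT, hA, hF⟩
      refine ⟨T, Y, Z + κ ρ * Y + κ τ, hi' Y Z hi, hT, ?_, by rwa [hm']⟩
      have hs' : κ s ≠ 0 := by simpa using hs
      convert hA using 1
      simp only [hp, map_zero, map_div₀, map_neg]
      field_simp
      ring
  · obtain ⟨ε, hε⟩ := IsAlgClosed.exists_pow_nat_eq (-p / r) (n := 2) (by norm_num)
    have hε0 : ε ≠ 0 := by
      rintro rfl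
      exact div_ne_zero (neg_ne_zero.2 hp) hr (by simpa using hε.symm)
    have hp' : p = -(r * ε ^ 2) := by
      rw [hε]
      field_simp
    obtain ⟨σ, hσ⟩ : ∃ σ, s = 2 * p * σ := ⟨s / (2 * p), by field_simp⟩
    refine (hyperbola_comp (K := K) (-(2 * ε)⁻¹) (2 * ε * r)⁻¹ (-σ) (2⁻¹ + ρ * (2 * ε)⁻¹)
      ((2 * r)⁻¹ - ρ * (2 * ε * r)⁻¹) (ρ * σ - τ) (d - p * σ ^ 2) k).mono ?_
    rintro a ⟨T, Y, Z, hi, hT, hA, hF⟩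
    have hr' : κ r ≠ 0 := by simpa using hr
    have he' : κ ε ≠ 0 := by simpa using hε0
    have h2' : (2 : K) ≠ 0 := by
      rw [← map_ofNat κ 2]
      exact (map_ne_zero κ).2 two_ne_zero
    refine ⟨T, Z + κ ρ * Y + κ τ - κ ε * (Y + κ σ),
      κ r * (Z + κ ρ * Y + κ τ + κ ε * (Y + κ σ)), Y, Z, ?_, ?_, hi, hT, ?_, hF⟩
    · simp only [map_neg, map_inv₀, map_mul, map_ofNat]
      field_simp
      ring
    · simp only [map_inv₀, map_mul, map_ofNat, map_sub, map_add]
      field_simp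
      ring
    · convert hA using 1
      simp only [hσ, hp', map_neg, map_mul, map_ofNat, map_sub, map_pow]
      ring

lemma caseB_core (g : Fin 6 → ℂ) (k : Fin 10 → ℂ)
    (h1 : ¬ (g 0 = 0 ∧ g 1 = 0 ∧ g 2 = 0 ∧ g 3 = 0 ∧ g 4 = 0))
    (h2 : ¬ (g 1 = 0 ∧ g 2 = 0 ∧ g 4 = 0 ∧ k 1 = 0 ∧ k 2 = 0 ∧ k 5 = 0 ∧ k 6 = 0 ∧ k 8 = 0)) :
    QuadricCovered {a | ∃ T Y Z : K, ¬ (Fin' Y ∧ Fin' Z) ∧ Lim T (a 1) ∧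
      Lim (bq g Y Z) (a 2) ∧ Lim (T * Y + cub k Y Z) (a 0)} := by
  by_cases hr : g 2 = 0
  swap
  · obtain ⟨ρ, hρ⟩ : ∃ ρ, g 1 = 2 * g 2 * ρ := ⟨g 1 / (2 * g 2), by field_simp⟩
    obtain ⟨τ, hτ⟩ : ∃ τ, g 4 = 2 * g 2 * τ := ⟨g 4 / (2 * g 2), by field_simp⟩
    refine (conic_shear (K := K) ρ τ (g 0 - g 2 * ρ ^ 2) (g 2) (g 3 - 2 * g 2 * ρ * τ)
      (g 5 - g 2 * τ ^ 2) hr k).mono ?_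
    rintro a ⟨T, Y, Z, hi, hT, hA, hF⟩
    refine ⟨T, Y, Z, hi, hT, ?_, hF⟩
    convert hA using 1
    simp only [bq, hρ, hτ, map_mul, map_ofNat, map_sub, map_pow]
    ring
  by_cases hq : g 1 = 0
  swap
  · obtain ⟨t, ht⟩ : ∃ t, g 4 = g 1 * t := ⟨g 4 / g 1, by field_simp⟩
    refine (hyperbola_comp (K := K) 1 0 (-t) (-g 0 / g 1) (g 1)⁻¹
      (-(g 3 - g 0 * t) / g 1 + g 0 / g 1 * t) (g 5 - g 3 * t + g 0 * t ^ 2) k).mono ?_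
    rintro a ⟨T, Y, Z, hi, hT, hA, hF⟩
    have hq' : κ (g 1) ≠ 0 := by simpa using hq
    refine ⟨T, Y + κ t, κ (g 1) * Z + κ (g 0) * Y + κ (g 3 - g 0 * t), Y, Z, ?_, ?_, hi, hT,
      ?_, hF⟩
    · simp
    · simp only [map_neg, map_inv₀, map_mul, map_sub, map_add, map_div₀]
      field_simp
      ring
    · convert hA using 1
      simp only [bq, hr, ht, map_mul, map_sub, map_pow, map_add, map_zero]
      ring
  by_cases ht : g 4 = 0
  swap
  · have ht' : κ (g 4) ≠ 0 := by simpa using ht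
    obtain ⟨m, hm⟩ := exists_cub_comp (K := K) k 1 0 0 (-(g 3 / g 4)) 1 0
    have hm' : ∀ Y Z : K, cub m Y (Z + κ (g 3 / g 4) * Y) = cub k Y Z := fun Y Z => by
      rw [hm]
      congr 1 <;> simp
    have hi' : ∀ Y Z : K, ¬ (Fin' Y ∧ Fin' Z) →
        ¬ (Fin' Y ∧ Fin' (Z + κ (g 3 / g 4) * Y)) := by
      rintro Y Z hi ⟨h1, h2⟩
      refine hi ⟨h1, ?_⟩
      convert fin_affine h1 h2 (-(g 3 / g 4)) 1 0 using 1
      simp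
    by_cases hp : g 0 = 0
    · refine (parallel_lines (K := K) 0 (g 4) (g 5) (by simp [ht]) m).mono ?_
      rintro a ⟨T, Y, Z, hi, hT, hA, hF⟩
      refine ⟨T, Y, _, hi' Y Z hi, hT, ?_, by rwa [hm']⟩
      convert hA using 1
      simp only [bq, hp, hq, hr, map_zero, map_div₀]
      field_simp
      ring
    · refine (parabola_second (K := K) (-g 0 / g 4) (g 4) (g 5) (by simp [hp, ht]) ht m).mono ?_
      rintro a ⟨T, Y, Z, hi, hT, hA, hF⟩
      refine ⟨T, Y, _, hi' Y Z hi, hT, ?_, by rwa [hm']⟩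
      convert hA using 1
      simp only [bq, hq, hr, map_zero, map_div₀, map_neg]
      field_simp
      ring
  refine (vertical_lines (K := K) (g 0) (g 3) (g 5) (by tauto) k (by tauto)).mono ?_
  rintro a ⟨T, Y, Z, hi, hT, hA, hF⟩
  refine ⟨T, Y, Z, hi, hT, ?_, hF⟩
  convert hA using 1
  simp only [bq, hq, hr, ht, map_zero]
  ring

lemma lim_quadratic (a b c : ℂ) {W : K} {w : ℂ} (hw : Lim W w) :
    Lim (κ a * W ^ 2 + κ b * W + κ c) (a * w ^ 2 + b * w + c) := by
  apply_rules [lim_add, lim_mul, lim_cst, lim_pow]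

/-- Pairs of binary quadratics without pure square in the first variable. -/
lemma planar_normalized (p₁ b₁ q₁ c₁ d₁ p₂ b₂ q₂ c₂ d₂ : ℂ)
    (hnd : ∀ A B C A' B' C' : ℂ, ¬ ∀ U W : K, ∃ s : K,
      U * (κ p₁ * W + κ b₁) + κ q₁ * W ^ 2 + κ c₁ * W + κ d₁ = κ A * s ^ 2 + κ B * s + κ C ∧
      U * (κ p₂ * W + κ b₂) + κ q₂ * W ^ 2 + κ c₂ * W + κ d₂
        = κ A' * s ^ 2 + κ B' * s + κ C') :
    QuadricCovered {a | ∃ U W : K, ¬ (Fin' U ∧ Fin' W) ∧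
      Lim (U * (κ p₁ * W + κ b₁) + κ q₁ * W ^ 2 + κ c₁ * W + κ d₁) (a 1) ∧
      Lim (U * (κ p₂ * W + κ b₂) + κ q₂ * W ^ 2 + κ c₂ * W + κ d₂) (a 2)} := by
  by_cases hD : p₁ * b₂ - p₂ * b₁ = 0
  · obtain ⟨n₁, n₂, hn, hp, hb⟩ : ∃ n₁ n₂ : ℂ, ¬ (n₁ = 0 ∧ n₂ = 0) ∧
        n₁ * p₁ + n₂ * p₂ = 0 ∧ n₁ * b₁ + n₂ * b₂ = 0 := by
      by_cases h : p₁ = 0 ∧ p₂ = 0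
      · by_cases h' : b₁ = 0 ∧ b₂ = 0
        · exact ⟨1, 0, by simp, by simp [h.1], by simp [h'.1]⟩
        · exact ⟨b₂, -b₁, fun e => h' ⟨neg_eq_zero.1 e.2, e.1⟩, by simp [h], by ring⟩
      · exact ⟨p₂, -p₁, fun e => h ⟨neg_eq_zero.1 e.2, e.1⟩, by ring, by linear_combination -hD⟩
    have hφ : ∀ U W : K,
        κ n₁ * (U * (κ p₁ * W + κ b₁) + κ q₁ * W ^ 2 + κ c₁ * W + κ d₁) +
        κ n₂ * (U * (κ p₂ * W + κ b₂) + κ q₂ * W ^ 2 + κ c₂ * W + κ d₂) =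
        κ (n₁ * q₁ + n₂ * q₂) * W ^ 2 + κ (n₁ * c₁ + n₂ * c₂) * W + κ (n₁ * d₁ + n₂ * d₂) := by
      intro U W
      have hp' := congrArg κ hp
      have hb' := congrArg κ hb
      simp only [map_add, map_mul, map_zero] at hp' hb' ⊢
      linear_combination U * W * hp' + U * hb'
    have hqc : ¬ (n₁ * q₁ + n₂ * q₂ = 0 ∧ n₁ * c₁ + n₂ * c₂ = 0) := by
      rintro ⟨hq, hc⟩
      simp only [hq, hc, map_zero, zero_mul, zero_add] at hφ
      by_cases h1 : n₁ = 0
      · have h2 : n₂ ≠ 0 := fun h2 => hn ⟨h1, h2⟩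
        have h2' : κ n₂ ≠ 0 := by simpa using h2
        refine hnd 0 1 0 0 0 ((n₁ * d₁ + n₂ * d₂) / n₂) fun U W => ?_
        have := hφ U W
        generalize U * (κ p₁ * W + κ b₁) + κ q₁ * W ^ 2 + κ c₁ * W + κ d₁ = x at this ⊢
        generalize U * (κ p₂ * W + κ b₂) + κ q₂ * W ^ 2 + κ c₂ * W + κ d₂ = y at this ⊢
        refine ⟨x, by simp, ?_⟩
        rw [map_div₀, ← this, h1]
        simp only [map_zero]
        field_simp
        ring
      · have h1' : κ n₁ ≠ 0 := by simpa using h1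
        refine hnd 0 (-n₂ / n₁) ((n₁ * d₁ + n₂ * d₂) / n₁) 0 1 0 fun U W => ?_
        have := hφ U W
        generalize U * (κ p₁ * W + κ b₁) + κ q₁ * W ^ 2 + κ c₁ * W + κ d₁ = x at this ⊢
        generalize U * (κ p₂ * W + κ b₂) + κ q₂ * W ^ 2 + κ c₂ * W + κ d₂ = y at this ⊢
        refine ⟨y, ?_, by simp⟩
        rw [map_div₀ κ (_ + _), ← this]
        simp only [map_zero, map_div₀, map_neg]
        field_simp
        ring
    have key : ∀ (a : Fin 3 → ℂ) (U W : K), ¬ (Fin' U ∧ Fin' W) →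
        Lim (U * (κ p₁ * W + κ b₁) + κ q₁ * W ^ 2 + κ c₁ * W + κ d₁) (a 1) →
        Lim (U * (κ p₂ * W + κ b₂) + κ q₂ * W ^ 2 + κ c₂ * W + κ d₂) (a 2) →
        ∃ w, p₁ * w + b₁ = 0 ∧ p₂ * w + b₂ = 0 ∧ n₁ * a 1 + n₂ * a 2 =
          (n₁ * q₁ + n₂ * q₂) * w ^ 2 + (n₁ * c₁ + n₂ * c₂) * w + (n₁ * d₁ + n₂ * d₂) := by
      intro a U W hi h1 h2
      have h3 := lim_add (lim_mul (lim_cst n₁) h1) (lim_mul (lim_cst n₂) h2)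
      rw [hφ] at h3
      obtain ⟨w, hw⟩ := fin_of_lim_quadratic hqc h3
      have hU : Infinite' U := not_fin.1 fun hU => hi ⟨hU, w, hw⟩
      have hlin : ∀ p b q c d e : ℂ,
          Lim (U * (κ p * W + κ b) + κ q * W ^ 2 + κ c * W + κ d) e → p * w + b = 0 := by
        intro p b q c d e h
        have ht : Lim (κ q * W ^ 2 + κ c * W + κ d) (q * w ^ 2 + c * w + d) := by
          apply_rules [lim_add, lim_mul, lim_cst, lim_pow]
        refine lim_unique (lim_add (lim_mul (lim_cst p) hw) (lim_cst b)) ?_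
        exact peel hU h ht (by ring)
      refine ⟨w, hlin _ _ _ _ _ _ h1, hlin _ _ _ _ _ _ h2, lim_unique h3 ?_⟩
      apply_rules [lim_add, lim_mul, lim_cst, lim_pow]
    by_cases hp₁ : p₁ = 0
    · by_cases hp₂ : p₂ = 0
      · refine empty.mono ?_
        rintro a ⟨U, W, hi, h1, h2⟩
        obtain ⟨w, e1, e2, -⟩ := key a U W hi h1 h2
        refine hnd q₁ c₁ d₁ q₂ c₂ d₂ fun U W => ⟨W, ?_, ?_⟩
        · have : b₁ = 0 := by simpa [hp₁] using e1
          simp [hp₁, this]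
        · have : b₂ = 0 := by simpa [hp₂] using e2
          simp [hp₂, this]
      · refine plane_of 0 n₁ n₂ (-((n₁ * q₁ + n₂ * q₂) * (-b₂ / p₂) ^ 2 +
          (n₁ * c₁ + n₂ * c₂) * (-b₂ / p₂) + (n₁ * d₁ + n₂ * d₂))) (by simpa using hn) ?_
        rintro a ⟨U, W, hi, h1, h2⟩
        obtain ⟨w, e1, e2, e3⟩ := key a U W hi h1 h2
        have : w = -b₂ / p₂ := by
          rw [eq_div_iff hp₂]
          linear_combination e2
        rw [← this]
        linear_combination e3
    · refine plane_of 0 n₁ n₂ (-((n₁ * q₁ + n₂ * q₂) * (-b₁ / p₁) ^ 2 +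
        (n₁ * c₁ + n₂ * c₂) * (-b₁ / p₁) + (n₁ * d₁ + n₂ * d₂))) (by simpa using hn) ?_
      rintro a ⟨U, W, hi, h1, h2⟩
      obtain ⟨w, e1, e2, e3⟩ := key a U W hi h1 h2
      have : w = -b₁ / p₁ := by
        rw [eq_div_iff hp₁]
        linear_combination e1
      rw [← this]
      linear_combination e3
  · obtain ⟨D, hDdef⟩ : ∃ D, D = p₁ * b₂ - p₂ * b₁ := ⟨_, rfl⟩
    rw [← hDdef] at hD
    have hD' : κ D ≠ 0 := by simpa using hD
    have hDκ : κ D = κ p₁ * κ b₂ - κ p₂ * κ b₁ := by simp [hDdef]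
    refine plane_of 0 (-p₂) p₁ ((b₂ * c₁ - b₁ * c₂) - (p₁ * d₂ - p₂ * d₁)) ?_ ?_
    · rintro ⟨-, h2, h1⟩
      exact hD (by rw [hDdef, h1, neg_eq_zero.1 h2]; ring)
    rintro a ⟨U, W, hi, h1, h2⟩
    have hN := lim_add (lim_mul (lim_cst (-p₂)) h1) (lim_mul (lim_cst p₁) h2)
    have hM := lim_add (lim_mul (lim_cst b₂) h1) (lim_mul (lim_cst (-b₁)) h2)
    obtain ⟨N, hNdef⟩ : ∃ N, N = κ (-p₂) * (U * (κ p₁ * W + κ b₁) + κ q₁ * W ^ 2 + κ c₁ * W + κ d₁)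
      + κ p₁ * (U * (κ p₂ * W + κ b₂) + κ q₂ * W ^ 2 + κ c₂ * W + κ d₂) := ⟨_, rfl⟩
    rw [← hNdef] at hN
    have hW : Infinite' W := by
      refine not_fin.1 fun ⟨w, hw⟩ => hi ⟨?_, w, hw⟩
      have hU : U = (N - (κ (p₁ * q₂ - p₂ * q₁) * W ^ 2 + κ (p₁ * c₂ - p₂ * c₁) * W +
          κ (p₁ * d₂ - p₂ * d₁))) * κ D⁻¹ := by
        rw [hNdef, map_inv₀]
        field_simp
        simp only [map_sub, map_mul, map_neg, hDκ]
        ring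
      rw [hU]
      exact ⟨_, lim_mul (lim_sub hN (lim_quadratic _ _ _ hw)) (lim_cst _)⟩
    have hS1 : Lim (N + κ ((b₂ * c₁ - b₁ * c₂) - (p₁ * d₂ - p₂ * d₁)) +
        W * (κ ((b₂ * q₁ - b₁ * q₂) - (p₁ * c₂ - p₂ * c₁)) + W * κ (p₂ * q₁ - p₁ * q₂))) 0 := by
      refine peel hW hM (lim_cst (b₂ * d₁ - b₁ * d₂)) ?_
      simp only [map_sub, map_mul, map_neg, hNdef]
      ring
    have ht := lim_add hN (lim_cst ((b₂ * c₁ - b₁ * c₂) - (p₁ * d₂ - p₂ * d₁)))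
    have hS2 := peel hW hS1 ht rfl
    have h3 := lim_cst_zero (peel hW hS2 (lim_cst _) rfl)
    rw [h3, map_zero, mul_zero, add_zero] at hS2
    rw [h3, lim_cst_zero hS2, map_zero, mul_zero, add_zero, mul_zero, add_zero] at hS1
    linear_combination lim_unique ht hS1

lemma bq_comp (g : Fin 6 → ℂ) (v₁ v₂ w₁ w₂ : ℂ)
    (hv : g 0 * v₁ ^ 2 + g 1 * v₁ * v₂ + g 2 * v₂ ^ 2 = 0) (U W : K) :
    bq g (κ v₁ * U + κ w₁ * W) (κ v₂ * U + κ w₂ * W) =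
      U * (κ (2 * g 0 * v₁ * w₁ + g 1 * (v₁ * w₂ + v₂ * w₁) + 2 * g 2 * v₂ * w₂) * W +
        κ (g 3 * v₁ + g 4 * v₂)) + κ (g 0 * w₁ ^ 2 + g 1 * w₁ * w₂ + g 2 * w₂ ^ 2) * W ^ 2 +
        κ (g 3 * w₁ + g 4 * w₂) * W + κ (g 5) := by
  have := congrArg κ hv
  simp only [bq, map_add, map_mul, map_pow, map_zero, map_ofNat] at this ⊢
  linear_combination U ^ 2 * this

lemma bq_top_eq_zero {g : Fin 6 → ℂ} {Y r : K} {ρ b : ℂ} (hY : Infinite' Y) (hr : Lim r ρ)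
    (h : Lim (bq g Y (Y * r)) b) : g 0 + g 1 * ρ + g 2 * ρ ^ 2 = 0 := by
  have ht1 : Lim (κ (g 3) + κ (g 4) * r) (g 3 + g 4 * ρ) := by
    apply_rules [lim_add, lim_mul, lim_cst]
  have ht2 : Lim (κ (g 0) + κ (g 1) * r + κ (g 2) * r ^ 2) (g 0 + g 1 * ρ + g 2 * ρ ^ 2) := by
    apply_rules [lim_add, lim_mul, lim_cst, lim_pow]
  have hS1 : Lim (κ (g 3) + κ (g 4) * r + Y * (κ (g 0) + κ (g 1) * r + κ (g 2) * r ^ 2)) 0 := by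
    refine peel hY h (lim_cst (g 5)) ?_
    simp only [bq]
    ring
  exact lim_unique ht2 (peel hY hS1 ht1 rfl)

lemma exists_top_zero {g g' : Fin 6 → ℂ} {Y Z : K} {b b' : ℂ} (hi : ¬ (Fin' Y ∧ Fin' Z))
    (h : Lim (bq g Y Z) b) (h' : Lim (bq g' Y Z) b') :
    ∃ v₁ v₂ : ℂ, ¬ (v₁ = 0 ∧ v₂ = 0) ∧ g 0 * v₁ ^ 2 + g 1 * v₁ * v₂ + g 2 * v₂ ^ 2 = 0 ∧
      g' 0 * v₁ ^ 2 + g' 1 * v₁ * v₂ + g' 2 * v₂ ^ 2 = 0 := by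
  by_cases hY : Infinite' Y ∧ Fin' (Z * Y⁻¹)
  · obtain ⟨hY, ρ, hρ⟩ := hY
    have hZ : Z = Y * (Z * Y⁻¹) := by
      field_simp [hY.1]
    rw [hZ] at h h'
    refine ⟨1, ρ, by simp, ?_, ?_⟩
    · simpa using bq_top_eq_zero hY hρ h
    · simpa using bq_top_eq_zero hY hρ h'
  · obtain ⟨hZ, hYZ⟩ : Infinite' Z ∧ Lim (Y * Z⁻¹) 0 := by
      by_cases hY' : Fin' Y
      · have hZ : Infinite' Z := not_fin.1 fun hZ => hi ⟨hY', hZ⟩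
        exact ⟨hZ, hZ.lim_div hY'.choose_spec⟩
      · have hYi := not_fin.1 hY'
        have hq := not_fin.1 fun hq => hY ⟨hYi, hq⟩
        have hlim : Lim (Y * Z⁻¹) 0 := by simpa [mul_comm] using hq.2
        refine ⟨not_fin.1 fun ⟨z, hz⟩ => ?_, hlim⟩
        have hZ0 : Z ≠ 0 := left_ne_zero_of_mul hq.1
        refine hYi.not_lim (a := 0 * z) ?_
        convert lim_mul hlim hz using 1
        field_simp
    have hY' : Y = Z * (Y * Z⁻¹) := by
      field_simp [hZ.1]
    have hsw : ∀ g : Fin 6 → ℂ, bq g Y Z =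
        bq ![g 2, g 1, g 0, g 4, g 3, g 5] Z (Z * (Y * Z⁻¹)) := by
      intro g
      rw [← hY']
      simp [bq]
      ring
    rw [hsw] at h h'
    refine ⟨0, 1, by simp, ?_, ?_⟩
    · simpa using bq_top_eq_zero hZ hYZ h
    · simpa using bq_top_eq_zero hZ hYZ h'

lemma planar (g g' : Fin 6 → ℂ)
    (hnd : ∀ A B C A' B' C' : ℂ, ¬ ∀ Y Z : K, ∃ s : K,
      bq g Y Z = κ A * s ^ 2 + κ B * s + κ C ∧ bq g' Y Z = κ A' * s ^ 2 + κ B' * s + κ C') :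
    QuadricCovered {a | ∃ Y Z : K, ¬ (Fin' Y ∧ Fin' Z) ∧
      Lim (bq g Y Z) (a 1) ∧ Lim (bq g' Y Z) (a 2)} := by
  by_cases hex : ∃ a : Fin 3 → ℂ, ∃ Y Z : K, ¬ (Fin' Y ∧ Fin' Z) ∧
      Lim (bq g Y Z) (a 1) ∧ Lim (bq g' Y Z) (a 2)
  swap
  · exact empty.mono fun a ha => hex ⟨a, ha⟩
  obtain ⟨a₀, Y₀, Z₀, hi₀, h₀, h₀'⟩ := hex
  obtain ⟨v₁, v₂, hv, hg, hg'⟩ := exists_top_zero hi₀ h₀ h₀'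
  obtain ⟨w₁, w₂, hw⟩ : ∃ w₁ w₂ : ℂ, v₁ * w₂ - v₂ * w₁ = 1 := by
    by_cases h : v₁ = 0
    · exact ⟨-v₂⁻¹, 0, by simp [h, mul_inv_cancel₀ (fun h2 => hv ⟨h, h2⟩ : v₂ ≠ 0)]⟩
    · exact ⟨0, v₁⁻¹, by simp [mul_inv_cancel₀ h]⟩
  have hw' : κ v₁ * κ w₂ - κ v₂ * κ w₁ = 1 := by simpa using congrArg κ hw
  have hY : ∀ Y Z : K, κ v₁ * (κ w₂ * Y - κ w₁ * Z) + κ w₁ * (κ v₁ * Z - κ v₂ * Y) = Y :=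
    fun Y Z => by linear_combination Y * hw'
  have hZ : ∀ Y Z : K, κ v₂ * (κ w₂ * Y - κ w₁ * Z) + κ w₂ * (κ v₁ * Z - κ v₂ * Y) = Z :=
    fun Y Z => by linear_combination Z * hw'
  refine (planar_normalized (K := K)
    (2 * g 0 * v₁ * w₁ + g 1 * (v₁ * w₂ + v₂ * w₁) + 2 * g 2 * v₂ * w₂) (g 3 * v₁ + g 4 * v₂)
    (g 0 * w₁ ^ 2 + g 1 * w₁ * w₂ + g 2 * w₂ ^ 2) (g 3 * w₁ + g 4 * w₂) (g 5)
    (2 * g' 0 * v₁ * w₁ + g' 1 * (v₁ * w₂ + v₂ * w₁) + 2 * g' 2 * v₂ * w₂)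
    (g' 3 * v₁ + g' 4 * v₂)
    (g' 0 * w₁ ^ 2 + g' 1 * w₁ * w₂ + g' 2 * w₂ ^ 2) (g' 3 * w₁ + g' 4 * w₂) (g' 5) ?_).mono ?_
  · intro A B C A' B' C' h
    refine hnd A B C A' B' C' fun Y Z => ?_
    have := h (κ w₂ * Y - κ w₁ * Z) (κ v₁ * Z - κ v₂ * Y)
    rwa [← bq_comp g v₁ v₂ w₁ w₂ hg, ← bq_comp g' v₁ v₂ w₁ w₂ hg', hY, hZ] at this
  · rintro a ⟨Y, Z, hi, h, h'⟩
    refine ⟨κ w₂ * Y - κ w₁ * Z, κ v₁ * Z - κ v₂ * Y, ?_, ?_, ?_⟩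
    · rintro ⟨h1, h2⟩
      refine hi ⟨?_, ?_⟩
      · have := fin_affine h1 h2 v₁ w₁ 0
        rwa [map_zero, add_zero, hY] at this
      · have := fin_affine h1 h2 v₂ w₂ 0
        rwa [map_zero, add_zero, hZ] at this
    · rwa [← bq_comp g v₁ v₂ w₁ w₂ hg, hY, hZ]
    · rwa [← bq_comp g' v₁ v₂ w₁ w₂ hg', hY, hZ]

/-- The polynomial whose evaluations are given by `bq`. -/
noncomputable def bqPoly (g : Fin 6 → ℂ) : MvPolynomial (Fin 2) ℂ :=
  open MvPolynomial in
  C (g 0) * X 0 ^ 2 + C (g 1) * X 0 * X 1 + C (g 2) * X 1 ^ 2 + C (g 3) * X 0 + C (g 4) * X 1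
    + C (g 5)

lemma eval₂_bqPoly (g : Fin 6 → ℂ) (s : Fin 2 → K) :
    (bqPoly g).eval₂ κ s = bq g (s 0) (s 1) := by
  simp [bqPoly, bq]

open MvPolynomial in
lemma caseA (μ ν : ℂ) (g₀ g₁ g₂ : Fin 6 → ℂ) {Φ : (Fin 3 → K) → Fin 3 → K}
    (h₀ : ∀ x, Φ x 0 = x 0 * (κ μ * x 1 + κ ν) + bq g₀ (x 1) (x 2))
    (h₁ : ∀ x, Φ x 1 = bq g₁ (x 1) (x 2)) (h₂ : ∀ x, Φ x 2 = bq g₂ (x 1) (x 2))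
    (hnd : NotOnSurface Φ) : QuadricCovered (infSet Φ) := by
  have hμν : ¬ (μ = 0 ∧ ν = 0) := by
    rintro ⟨rfl, rfl⟩
    refine hnd ![bqPoly g₀, bqPoly g₁, bqPoly g₂] fun x => ⟨![x 1, x 2], fun i => ?_⟩
    fin_cases i <;> simp [h₀, h₁, h₂, eval₂_bqPoly]
  have hpl := planar (K := K) g₁ g₂ fun A B c A' B' c' h => by
    refine hnd ![X 0, C A * X 1 ^ 2 + C B * X 1 + C c, C A' * X 1 ^ 2 + C B' * X 1 + C c']
      fun x => ?_
    obtain ⟨s, hs, hs'⟩ := h (x 1) (x 2)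
    refine ⟨![Φ x 0, s], fun i => ?_⟩
    fin_cases i <;> simp [h₁, h₂, hs, hs']
  refine (hpl.union (curve (g₁ 0 * (-ν / μ) ^ 2 + g₁ 3 * (-ν / μ) + g₁ 5)
    (g₁ 1 * (-ν / μ) + g₁ 4) (g₁ 2) (g₂ 0 * (-ν / μ) ^ 2 + g₂ 3 * (-ν / μ) + g₂ 5)
    (g₂ 1 * (-ν / μ) + g₂ 4) (g₂ 2))).mono ?_
  rintro a ⟨x, hi, ha⟩
  by_cases hfin : Fin' (x 1) ∧ Fin' (x 2)
  swap
  · exact Or.inl ⟨x 1, x 2, hfin, h₁ x ▸ ha 1, h₂ x ▸ ha 2⟩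
  obtain ⟨⟨y, hy⟩, z, hz⟩ := hfin
  have hX : Infinite' (x 0) := by
    refine not_fin.1 fun hX => hi fun i => ?_
    fin_cases i
    exacts [hX, ⟨y, hy⟩, ⟨z, hz⟩]
  have hbq : ∀ g : Fin 6 → ℂ, Lim (bq g (x 1) (x 2))
      (g 0 * y ^ 2 + g 1 * y * z + g 2 * z ^ 2 + g 3 * y + g 4 * z + g 5) := by
    intro g
    unfold bq
    apply_rules [lim_add, lim_mul, lim_cst, lim_pow]
  have h0 : μ * y + ν = 0 := by
    refine lim_unique (lim_add (lim_mul (lim_cst μ) hy) (lim_cst ν)) ?_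
    exact peel hX (ha 0) (hbq g₀) (by rw [h₀]; ring)
  have hμ : μ ≠ 0 := by
    rintro rfl
    exact hμν ⟨rfl, by simpa using h0⟩
  have hy' : y = -ν / μ := by
    rw [eq_div_iff hμ]
    linear_combination h0
  refine Or.inr ⟨z, ?_, ?_⟩
  · have h := ha 1
    rw [h₁] at h
    rw [← hy', lim_unique h (hbq g₁)]
    ring
  · have h := ha 2
    rw [h₂] at h
    rw [← hy', lim_unique h (hbq g₂)]
    ring

open MvPolynomial in
lemma caseB (g₀ g₁ g₂ : Fin 6 → ℂ) {Φ : (Fin 3 → K) → Fin 3 → K}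
    (h₀ : ∀ x, Φ x 0 = x 0 * x 1 + bq g₀ (x 1) (x 2))
    (h₁ : ∀ x, Φ x 1 = x 0 + bq g₁ (x 1) (x 2)) (h₂ : ∀ x, Φ x 2 = bq g₂ (x 1) (x 2))
    (hnd : NotOnSurface Φ) : QuadricCovered (infSet Φ) := by
  obtain ⟨k, hk⟩ : ∃ k : Fin 10 → ℂ, k = ![-g₁ 0, -g₁ 1, -g₁ 2, 0, g₀ 0 - g₁ 3, g₀ 1 - g₁ 4,
    g₀ 2, g₀ 3 - g₁ 5, g₀ 4, g₀ 5] := ⟨_, rfl⟩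
  have hcub : ∀ x, Φ x 0 = Φ x 1 * x 1 + cub k (x 1) (x 2) := by
    intro x
    rw [h₀, h₁, hk]
    simp [cub, bq]
    ring
  refine (caseB_core (K := K) g₂ k ?_ ?_).mono ?_
  · rintro ⟨e0, e1, e2, e3, e4⟩
    refine hnd ![X 0, X 1, C (g₂ 5)] fun x => ⟨![Φ x 0, Φ x 1], fun i => ?_⟩
    fin_cases i <;> simp [h₂, bq, e0, e1, e2, e3, e4]
  · rintro ⟨e1, e2, e4, k1, k2, k5, k6, k8⟩
    refine hnd ![X 0 * X 1 + (C (k 0) * X 1 ^ 3 + C (k 4) * X 1 ^ 2 + C (k 7) * X 1 + C (k 9)),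
      X 0, C (g₂ 0) * X 1 ^ 2 + C (g₂ 3) * X 1 + C (g₂ 5)]
      fun x => ⟨![Φ x 1, x 1], fun i => ?_⟩
    have k3 : k 3 = 0 := by simp [hk]
    fin_cases i
    · simp [hcub, cub, k1, k2, k3, k5, k6, k8]
    · simp
    · simp [h₂, bq, e1, e2, e4]
  · rintro a ⟨x, hi, ha⟩
    refine ⟨Φ x 1, x 1, x 2, ?_, ha 1, h₂ x ▸ ha 2, hcub x ▸ ha 0⟩
    rintro ⟨⟨y, hy⟩, z, hz⟩
    refine hi fun i => ?_
    fin_cases i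
    · refine ⟨a 1 - (g₁ 0 * y ^ 2 + g₁ 1 * y * z + g₁ 2 * z ^ 2 + g₁ 3 * y + g₁ 4 * z + g₁ 5), ?_⟩
      have : x 0 = Φ x 1 - bq g₁ (x 1) (x 2) := by rw [h₁]; ring
      simp only [Fin.zero_eta, this]
      refine lim_sub (ha 1) ?_
      unfold bq
      apply_rules [lim_add, lim_mul, lim_cst, lim_pow]
    exacts [⟨y, hy⟩, ⟨z, hz⟩]

/-- The quadratic mapping with the given coefficients. -/
def quad (A : Fin 3 → Fin 3 → Fin 3 → ℂ) (b : Fin 3 → Fin 3 → ℂ) (c : Fin 3 → ℂ)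
    (x : Fin 3 → K) (i : Fin 3) : K :=
  bil (fun j k => κ (A i j k)) x x + ∑ j, κ (b i j) * x j + κ (c i)

/-- The action of complex matrices on vectors. -/
def act (V : Matrix (Fin 3) (Fin 3) ℂ) (x : Fin 3 → K) : Fin 3 → K := (V.map κ).mulVec x

lemma act_apply (V : Matrix (Fin 3) (Fin 3) ℂ) (x : Fin 3 → K) (i : Fin 3) :
    act V x i = ∑ j, κ (V i j) * x j := rfl

lemma act_act {V V' : Matrix (Fin 3) (Fin 3) ℂ} (h : V * V' = 1) (x : Fin 3 → K) :
    act V (act V' x) = x := by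
  rw [act, act, Matrix.mulVec_mulVec, ← Matrix.map_mul, h]
  simp

lemma lim_act (V : Matrix (Fin 3) (Fin 3) ℂ) {x : Fin 3 → K} {a : Fin 3 → ℂ}
    (h : ∀ i, Lim (x i) (a i)) (i : Fin 3) : Lim (act V x i) (V.mulVec a i) := by
  simp only [act_apply, Matrix.mulVec, dotProduct, Fin.sum_univ_three]
  apply_rules [lim_add, lim_mul, lim_cst]

lemma linear_change {Φ : (Fin 3 → K) → Fin 3 → K}
    {N N' V V' : Matrix (Fin 3) (Fin 3) ℂ} (hN : N * N' = 1) (hN' : N' * N = 1)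
    (hV : V * V' = 1) (hnd : NotOnSurface Φ)
    (h : NotOnSurface (fun y => act N (Φ (act V y))) →
      QuadricCovered (infSet fun y => act N (Φ (act V y)))) :
    QuadricCovered (infSet Φ) := by
  refine (h fun G hG => ?_).comap N N' hN ?_
  · refine hnd (fun i => ∑ j, MvPolynomial.C (N' i j) * G j) fun x => ?_
    obtain ⟨s, hs⟩ := hG (act V' x)
    simp only [act_act hV] at hs
    refine ⟨s, fun i => ?_⟩
    rw [← act_act hN' (Φ x), act_apply]
    simp only [hs]
    simp [Fin.sum_univ_three]
  · rintro a ⟨x, hi, ha⟩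
    refine ⟨act V' x, fun hf => hi ?_, ?_⟩
    · choose y hy using hf
      intro i
      rw [← act_act hV x]
      exact ⟨_, lim_act V hy i⟩
    · simp only [act_act hV]
      exact lim_act N ha

/-- The coefficients of a component of a quadratic mapping, in the basis given by the columns of
`V`, in the last two variables. -/
def bqCoeff (A : Fin 3 → Fin 3 → Fin 3 → ℂ) (b : Fin 3 → Fin 3 → ℂ) (c : Fin 3 → ℂ)
    (V : Matrix (Fin 3) (Fin 3) ℂ) (i : Fin 3) : Fin 6 → ℂ :=
  ![bil (A i) (V · 1) (V · 1), bil (A i) (V · 1) (V · 2) + bil (A i) (V · 2) (V · 1),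
    bil (A i) (V · 2) (V · 2), ∑ j, b i j * V j 1, ∑ j, b i j * V j 2, c i]

lemma quad_act (A : Fin 3 → Fin 3 → Fin 3 → ℂ) (b : Fin 3 → Fin 3 → ℂ) (c : Fin 3 → ℂ)
    (V : Matrix (Fin 3) (Fin 3) ℂ) (y : Fin 3 → K) (i : Fin 3) :
    quad A b c (act V y) i =
      y 0 * (κ (bil (A i) (V · 0) (V · 0)) * y 0
        + κ (bil (A i) (V · 0) (V · 1) + bil (A i) (V · 1) (V · 0)) * y 1
        + κ (bil (A i) (V · 0) (V · 2) + bil (A i) (V · 2) (V · 0)) * y 2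
        + κ (∑ j, b i j * V j 0))
      + bq (bqCoeff A b c V i) (y 1) (y 2) := by
  simp [quad, bqCoeff, act_apply, bil, Fin.sum_univ_three, bq]
  ring

lemma act_affine (N : Matrix (Fin 3) (Fin 3) ℂ) (l α : Fin 3 → ℂ) (g : Fin 3 → Fin 6 → ℂ)
    (X T Y Z : K) (i : Fin 3) :
    act N (fun j => X * (κ (l j) * T + κ (α j)) + bq (g j) Y Z) i =
      X * (κ (N.mulVec l i) * T + κ (N.mulVec α i)) + bq (fun m => ∑ j, N i j * g j m) Y Z := by
  simp [act_apply, Matrix.mulVec, dotProduct, Fin.sum_univ_three, bq]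
  ring

/-- If `v` is a zero of the leading forms at which their derivative has a kernel transverse to
`v`, then the mapping reduces to one of the two cases of degree at most one in a variable. -/
lemma of_degenerate_zero (A : Fin 3 → Fin 3 → Fin 3 → ℂ) (b : Fin 3 → Fin 3 → ℂ) (c : Fin 3 → ℂ)
    (hnd : NotOnSurface (quad (K := K) A b c)) {v u : Fin 3 → ℂ} (hvu : crossProduct v u ≠ 0)
    (hv : ∀ i, bil (A i) v v = 0) (hu : ∀ i, bil (A i) v u + bil (A i) u v = 0) :
    QuadricCovered (infSet (quad (K := K) A b c)) := by
  obtain ⟨V, V', hVV, -, h0, h2⟩ := exists_matrix_of_cross_ne_zero hvu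
  have h0' : (V · 0) = v := funext h0
  have h2' : (V · 2) = u := funext h2
  obtain ⟨l, hl⟩ : ∃ l : Fin 3 → ℂ, l = fun i => bil (A i) v (V · 1) + bil (A i) (V · 1) v :=
    ⟨_, rfl⟩
  obtain ⟨α, hα⟩ : ∃ α : Fin 3 → ℂ, α = fun i => ∑ j, b i j * V j 0 := ⟨_, rfl⟩
  have hg : ∀ y : Fin 3 → K, quad A b c (act V y) =
      fun j => y 0 * (κ (l j) * y 1 + κ (α j)) + bq (bqCoeff A b c V j) (y 1) (y 2) := by
    refine fun y => funext fun i => ?_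
    rw [quad_act, h0', h2', hv, hu, hl, hα]
    simp only [map_zero, zero_mul, zero_add, add_zero]
  obtain ⟨G, hG⟩ : ∃ G : Matrix (Fin 3) (Fin 3) ℂ → Fin 3 → Fin 6 → ℂ, G = fun N i m =>
    ∑ j, N i j * bqCoeff A b c V j m := ⟨_, rfl⟩
  have hΨ : ∀ N (y : Fin 3 → K) i, act N (quad A b c (act V y)) i =
      y 0 * (κ (N.mulVec l i) * y 1 + κ (N.mulVec α i)) + bq (G N i) (y 1) (y 2) := by
    intro N y i
    rw [hg, act_affine, hG]
  by_cases hind : crossProduct l α = 0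
  · obtain ⟨N, N', μ, ν, hN, hN', hNl, hNα⟩ := exists_matrix_mulVec_eq_of_cross_eq_zero hind
    refine linear_change hN hN' hVV hnd fun hnd' => ?_
    refine caseA μ ν (G N 0) (G N 1) (G N 2) ?_ ?_ ?_ hnd' <;> intro y <;>
      simp [hΨ, hNl, hNα]
  · obtain ⟨N, N', hN, hN', hNl, hNα⟩ := exists_matrix_mulVec_eq hind
    refine linear_change hN hN' hVV hnd fun hnd' => ?_
    refine caseB (G N 0) (G N 1) (G N 2) ?_ ?_ ?_ hnd' <;> intro y <;>
      simp [hΨ, hNl, hNα]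

lemma lim_left_of_system {p q s t Y Z : K} {a b : ℂ} (hp : Lim p 1) (hq : Lim q 0) (hs : Lim s 0)
    (ht : Lim t 1) (h : Lim (p * Y + q * Z) a) (h' : Lim (s * Y + t * Z) b) : Lim Y a := by
  have hD : Lim (p * t - q * s) 1 := by simpa using lim_sub (lim_mul hp ht) (lim_mul hq hs)
  have hDY : Lim (t * (p * Y + q * Z) - q * (s * Y + t * Z)) a := by
    simpa using lim_sub (lim_mul ht h) (lim_mul hq h')
  have hD0 : p * t - q * s ≠ 0 := by
    intro h0
    rw [h0] at hD
    exact one_ne_zero (lim_unique hD lim_zero)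
  have hY : Y = (t * (p * Y + q * Z) - q * (s * Y + t * Z)) * (p * t - q * s)⁻¹ := by
    rw [eq_mul_inv_iff_mul_eq₀ hD0]
    ring
  rw [hY]
  simpa using lim_mul hDY (lim_inv hD one_ne_zero)

lemma lim_of_transverse (α β : ℂ) (g g' : Fin 6 → ℂ) {X Y Z : K} {a b : ℂ} (hX : Infinite' X)
    (hY : Lim (Y * X⁻¹) 0) (hZ : Lim (Z * X⁻¹) 0)
    (h : Lim (X * (Y + κ α) + bq g Y Z) a) (h' : Lim (X * (Z + κ β) + bq g' Y Z) b) :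
    Lim Y (-α) ∧ Lim Z (-β) := by
  have hX0 := hX.1
  have hsmall : ∀ r s t : ℂ, Lim (κ r * (Y * X⁻¹) + κ s * (Z * X⁻¹) + κ t * X⁻¹) 0 := by
    intro r s t
    simpa using lim_add (lim_add (lim_mul (lim_cst (K := K) r) hY) (lim_mul (lim_cst s) hZ))
      (lim_mul (lim_cst t) hX.2)
  have hp := lim_add (lim_one (K := K)) (hsmall (g 0) (g 1) (g 3))
  have hq := hsmall 0 (g 2) (g 4)
  have hs := hsmall (g' 0) (g' 1) (g' 3)
  have ht := lim_add (lim_one (K := K)) (hsmall 0 (g' 2) (g' 4))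
  rw [add_zero] at hp ht
  have e : Lim ((1 + (κ (g 0) * (Y * X⁻¹) + κ (g 1) * (Z * X⁻¹) + κ (g 3) * X⁻¹)) * Y
      + (κ 0 * (Y * X⁻¹) + κ (g 2) * (Z * X⁻¹) + κ (g 4) * X⁻¹) * Z) (-α) := by
    have := lim_sub (hX.lim_div h) (lim_add (lim_cst (K := K) α) (hsmall 0 0 (g 5)))
    rw [zero_sub, add_zero] at this
    convert this using 1
    simp only [bq, map_zero]
    field_simp
    ring
  have e' : Lim ((κ (g' 0) * (Y * X⁻¹) + κ (g' 1) * (Z * X⁻¹) + κ (g' 3) * X⁻¹) * Y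
      + (1 + (κ 0 * (Y * X⁻¹) + κ (g' 2) * (Z * X⁻¹) + κ (g' 4) * X⁻¹)) * Z) (-β) := by
    have := lim_sub (hX.lim_div h') (lim_add (lim_cst (K := K) β) (hsmall 0 0 (g' 5)))
    rw [zero_sub, add_zero] at this
    convert this using 1
    simp only [bq, map_zero]
    field_simp
    ring
  refine ⟨lim_left_of_system hp hq hs ht e e', ?_⟩
  rw [add_comm] at e e'
  exact lim_left_of_system ht hs hq hp e' e

lemma bil_add_right (A : Fin 3 → Fin 3 → ℂ) (v w u : Fin 3 → ℂ) (r s : ℂ) :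
    bil A v (r • w + s • u) + bil A (r • w + s • u) v =
      r * (bil A v w + bil A w v) + s * (bil A v u + bil A u v) := by
  simp [bil, Fin.sum_univ_three]
  ring

/-- The limits at points going to infinity in the direction of a zero `v` of the leading forms
whose derivative has kernel spanned by `v` lie on a plane. -/
lemma of_nondegenerate_zero (A : Fin 3 → Fin 3 → Fin 3 → ℂ) (b : Fin 3 → Fin 3 → ℂ)
    (c : Fin 3 → ℂ) {v : Fin 3 → ℂ} {i₀ : Fin 3} (hi₀ : v i₀ = 1)
    (hv : ∀ i, bil (A i) v v = 0)
    (hu : ∀ u, (∀ i, bil (A i) v u + bil (A i) u v = 0) → crossProduct v u = 0) :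
    QuadricCovered {a | ∃ x : Fin 3 → K, Infinite' (x i₀) ∧
      (∀ j, Lim (x j * (x i₀)⁻¹) (v j)) ∧ ∀ j, Lim (quad A b c x j) (a j)} := by
  have hv0 : v ≠ 0 := fun h => by simp [h] at hi₀
  obtain ⟨u, hvu⟩ := exists_cross_ne_zero hv0
  obtain ⟨V, V', hVV, hVV', h0, h2⟩ := exists_matrix_of_cross_ne_zero hvu
  have h0' : (V · 0) = v := funext h0
  have h2' : (V · 2) = u := funext h2
  obtain ⟨w, hw⟩ : ∃ w : Fin 3 → ℂ, (V · 1) = w := ⟨_, rfl⟩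
  have hVv : V'.mulVec v = ![1, 0, 0] := by
    have : V.mulVec ![1, 0, 0] = v := by
      ext i
      simp [Matrix.mulVec, dotProduct, Fin.sum_univ_three, h0]
    rw [← this, Matrix.mulVec_mulVec, hVV', Matrix.one_mulVec]
  have hVwu : ∀ r s : ℂ, V'.mulVec (r • w + s • u) = ![0, r, s] := by
    intro r s
    have : V.mulVec ![0, r, s] = r • w + s • u := by
      ext i
      have := congrFun hw i
      simp [Matrix.mulVec, dotProduct, Fin.sum_univ_three, h2, ← this]
      ring
    rw [← this, Matrix.mulVec_mulVec, hVV', Matrix.one_mulVec]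
  obtain ⟨l, hl⟩ : ∃ l : Fin 3 → ℂ, l = fun i => bil (A i) v w + bil (A i) w v := ⟨_, rfl⟩
  obtain ⟨m, hm⟩ : ∃ m : Fin 3 → ℂ, m = fun i => bil (A i) v u + bil (A i) u v := ⟨_, rfl⟩
  have hlm : crossProduct l m ≠ 0 := by
    rw [crossProduct_ne_zero_iff_linearIndependent, LinearIndependent.pair_iff]
    intro r s hrs
    have hcross := hu (r • w + s • u) fun i => by
      have := congrFun hrs i
      simp only [hl, hm, Pi.add_apply, Pi.smul_apply, smul_eq_mul, Pi.zero_apply] at this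
      rw [bil_add_right, this]
    by_contra hne
    refine absurd hcross ?_
    rw [← ne_eq, crossProduct_ne_zero_iff_linearIndependent, LinearIndependent.pair_iff]
    intro p q hpq
    have := congrArg V'.mulVec hpq
    rw [Matrix.mulVec_add, Matrix.mulVec_smul, Matrix.mulVec_smul, hVv, hVwu,
      Matrix.mulVec_zero] at this
    have t0 := congrFun this 0
    have t1 := congrFun this 1
    have t2 := congrFun this 2
    simp at t0 t1 t2
    tauto
  obtain ⟨N, N', hN, hN', hNl, hNm⟩ := exists_matrix_mulVec_eq hlm
  obtain ⟨α, hα⟩ : ∃ α : Fin 3 → ℂ, α = N.mulVec fun i => ∑ j, b i j * V j 0 := ⟨_, rfl⟩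
  obtain ⟨g, hg⟩ : ∃ g : Fin 3 → Fin 6 → ℂ, g = fun i k => ∑ j, N i j * bqCoeff A b c V j k :=
    ⟨_, rfl⟩
  have hΨ : ∀ (y : Fin 3 → K) i, act N (quad A b c (act V y)) i =
      y 0 * (κ (N.mulVec l i) * y 1 + κ (N.mulVec m i) * y 2 + κ (α i))
        + bq (g i) (y 1) (y 2) := by
    intro y i
    rw [act_apply]
    simp only [quad_act, h0', h2', hw, hv]
    simp [hl, hm, hα, hg, Fin.sum_univ_three, Matrix.mulVec, dotProduct, bq]
    ring
  refine (last_eq (g 2 0 * (-α 0) ^ 2 + g 2 1 * (-α 0) * (-α 1) + g 2 2 * (-α 1) ^ 2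
    + g 2 3 * (-α 0) + g 2 4 * (-α 1) + g 2 5)).comap N N' hN ?_
  rintro a ⟨x, hx, hxv, hxa⟩
  have hxV := lim_act V' hxv
  rw [hVv] at hxV
  have hscale : ∀ j, act V' (fun k => x k * (x i₀)⁻¹) j = act V' x j * (x i₀)⁻¹ := by
    intro j
    simp only [act_apply, Fin.sum_univ_three]
    ring
  simp only [hscale] at hxV
  obtain ⟨y, hy⟩ : ∃ y : Fin 3 → K, y = act V' x := ⟨_, rfl⟩
  have hxy : x = act V y := by rw [hy, act_act hVV]
  rw [← hy] at hxV
  have hy0 : Lim (y 0 * (x i₀)⁻¹) 1 := hxV 0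
  have hX : Infinite' (y 0) := by
    have := hx.mul_lim hy0 one_ne_zero
    rwa [mul_comm, mul_assoc, inv_mul_cancel₀ hx.1, mul_one] at this
  have hdiv : ∀ z : K, Lim (z * (x i₀)⁻¹) 0 → Lim (z * (y 0)⁻¹) 0 := by
    intro z hz
    have := lim_mul hz (lim_inv hy0 one_ne_zero)
    rw [zero_mul] at this
    convert this using 1
    have := hx.1
    have := hX.1
    field_simp
  have hlim := lim_act N hxa
  simp only [hxy, hΨ, hNl, hNm] at hlim
  have hl0 := hlim 0
  have hl1 := hlim 1
  have hl2 := hlim 2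
  simp only [Matrix.cons_val, map_zero, map_one, zero_mul, one_mul, zero_add, add_zero]
    at hl0 hl1 hl2
  obtain ⟨hY, hZ⟩ := lim_of_transverse _ _ _ _ hX (hdiv _ (hxV 1)) (hdiv _ (hxV 2)) hl0 hl1
  have hb : Lim (bq (g 2) (y 1) (y 2)) (g 2 0 * (-α 0) ^ 2 + g 2 1 * (-α 0) * (-α 1)
      + g 2 2 * (-α 1) ^ 2 + g 2 3 * (-α 0) + g 2 4 * (-α 1) + g 2 5) := by
    rw [bq]
    apply_rules [lim_add, lim_mul, lim_cst, lim_pow]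
  have hα2 := lim_cst_eq (peel hX hl2 hb (add_comm _ _))
  rw [hα2, map_zero, mul_zero, zero_add] at hl2
  exact lim_unique hl2 hb

lemma exists_max_aux {ι : Type*} (x : ι → K) {s : Finset ι} (hs : s.Nonempty)
    (h0 : ∀ i ∈ s, x i ≠ 0) : ∃ j ∈ s, ∀ k ∈ s, Fin' (x k * (x j)⁻¹) := by
  classical
  induction hs using Finset.Nonempty.cons_induction with
  | singleton a =>
    refine ⟨a, by simp, fun k hk => ⟨1, ?_⟩⟩
    rw [Finset.mem_singleton.1 hk, mul_inv_cancel₀ (h0 a (by simp))]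
    exact lim_one
  | cons a s ha hs ih =>
    obtain ⟨j, hj, hjs⟩ := ih fun i hi => h0 i (Finset.mem_cons_of_mem hi)
    by_cases hf : Fin' (x a * (x j)⁻¹)
    · refine ⟨j, Finset.mem_cons_of_mem hj, fun k hk => ?_⟩
      rcases Finset.mem_cons.1 hk with rfl | hk
      exacts [hf, hjs k hk]
    · have hx0 := h0 a (Finset.mem_cons_self a s)
      have hxj := h0 j (Finset.mem_cons_of_mem hj)
      refine ⟨a, Finset.mem_cons_self a s, fun k hk => ?_⟩
      rcases Finset.mem_cons.1 hk with rfl | hk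
      · exact ⟨1, by simpa [hx0] using lim_one⟩
      · obtain ⟨r, hr⟩ := hjs k hk
        refine ⟨r * 0, ?_⟩
        convert lim_mul hr (not_fin.1 hf).2 using 1
        field_simp

/-- A nonzero vector has a coordinate of maximal order. -/
lemma exists_max {x : Fin 3 → K} {i : Fin 3} (hi : x i ≠ 0) :
    ∃ j, x j ≠ 0 ∧ ∃ v : Fin 3 → ℂ, v j = 1 ∧ ∀ k, Lim (x k * (x j)⁻¹) (v k) := by
  classical
  obtain ⟨j, hj, hjs⟩ := exists_max_aux x (s := Finset.univ.filter fun i => x i ≠ 0)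
    ⟨i, by simpa using hi⟩ (by simp)
  have hj0 : x j ≠ 0 := by simpa using hj
  have hfin : ∀ k, Fin' (x k * (x j)⁻¹) := by
    intro k
    by_cases hk : x k = 0
    · exact ⟨0, by simpa [hk] using lim_zero⟩
    · exact hjs k (by simpa using hk)
  choose v hv using hfin
  refine ⟨j, hj0, v, ?_, hv⟩
  have := hv j
  rw [mul_inv_cancel₀ hj0] at this
  exact lim_unique this lim_one

lemma lim_sum {ι : Type*} (s : Finset ι) {x : ι → K} {a : ι → ℂ} (h : ∀ i, Lim (x i) (a i)) :
    Lim (∑ i ∈ s, x i) (∑ i ∈ s, a i) := by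
  classical
  induction s using Finset.induction_on with
  | empty => simpa using lim_zero
  | insert i s hi ih =>
    rw [Finset.sum_insert hi, Finset.sum_insert hi]
    exact lim_add (h i) ih

lemma lim_bil (A : Fin 3 → Fin 3 → ℂ) {x y : Fin 3 → K} {a b : Fin 3 → ℂ}
    (hx : ∀ i, Lim (x i) (a i)) (hy : ∀ i, Lim (y i) (b i)) :
    Lim (bil (fun j k => κ (A j k)) x y) (bil A a b) :=
  lim_sum _ fun j => lim_sum _ fun k => lim_mul (lim_mul (lim_cst _) (hx j)) (hy k)

lemma bil_smul_smul {R : Type} [CommRing R] (A : Fin 3 → Fin 3 → R) (r s : R) (x y : Fin 3 → R) :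
    bil A (fun i => r * x i) (fun i => s * y i) = r * s * bil A x y := by
  simp [bil, Fin.sum_univ_three]
  ring

/-- Points at infinity where the mapping is finite have the direction of a zero of the leading
forms. -/
lemma exists_direction {A : Fin 3 → Fin 3 → Fin 3 → ℂ} {b : Fin 3 → Fin 3 → ℂ} {c : Fin 3 → ℂ}
    {x : Fin 3 → K} (hx : ¬ ∀ i, Fin' (x i)) {a : Fin 3 → ℂ}
    (ha : ∀ i, Lim (quad A b c x i) (a i)) :
    ∃ j, Infinite' (x j) ∧ ∃ v : Fin 3 → ℂ, v j = 1 ∧ (∀ k, Lim (x k * (x j)⁻¹) (v k)) ∧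
      ∀ i, bil (A i) v v = 0 := by
  push Not at hx
  obtain ⟨i, hi⟩ := hx
  have hi' := not_fin.1 hi
  obtain ⟨j, hj0, v, hvj, hv⟩ := exists_max hi'.1
  have hj : Infinite' (x j) := by
    rw [← not_fin]
    rintro ⟨r, hr⟩
    refine hi ⟨v i * r, ?_⟩
    convert lim_mul (hv i) hr using 1
    field_simp
  refine ⟨j, hj, v, hvj, hv, fun i => ?_⟩
  have hlin : Lim (∑ k, κ (b i k) * (x k * (x j)⁻¹)) (∑ k, b i k * v k) :=
    lim_sum _ fun k => lim_mul (lim_cst _) (hv k)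
  have hsq := lim_bil (A i) hv hv
  have hxs : x = fun k => x j * (x k * (x j)⁻¹) := by
    ext k
    field_simp
  have h1 := peel hj (ha i) (lim_cst (c i)) (S := ∑ k, κ (b i k) * (x k * (x j)⁻¹)
    + x j * bil (fun j k => κ (A i j k)) (fun k => x k * (x j)⁻¹) fun k => x k * (x j)⁻¹) (by
      conv_lhs => rw [hxs]
      simp only [quad, bil_smul_smul, Fin.sum_univ_three]
      ring)
  exact lim_unique hsq (peel hj h1 hlin rfl)

/-- The normalized zeros of the leading forms. -/
def zeroSet (A : Fin 3 → Fin 3 → Fin 3 → ℂ) : Set (Fin 3 → ℂ) :=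
  {v | (∃ i, v i = 1) ∧ ∀ i, bil (A i) v v = 0}

lemma eval₂_bil (A : Fin 3 → Fin 3 → ℂ) (w : Fin 3 → K) :
    (bil (fun j k => MvPolynomial.C (A j k)) MvPolynomial.X MvPolynomial.X :
      MvPolynomial (Fin 3) ℂ).eval₂ κ w = bil (fun j k => κ (A j k)) w w := by
  simp [bil, Fin.sum_univ_three]

lemma eval_bil (A : Fin 3 → Fin 3 → ℂ) (w : Fin 3 → ℂ) :
    (bil (fun j k => MvPolynomial.C (A j k)) MvPolynomial.X MvPolynomial.X :
      MvPolynomial (Fin 3) ℂ).eval w = bil A w w := by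
  simp [bil, Fin.sum_univ_three]

lemma zeroSet_finite (hK : HasGenericPoints K) {A : Fin 3 → Fin 3 → Fin 3 → ℂ}
    (hA : ∀ v u, (∀ i, bil (A i) v v = 0) → (∀ i, bil (A i) v u + bil (A i) u v = 0) →
      crossProduct v u = 0) : (zeroSet A).Finite := by
  suffices H : ∀ i₀ : Fin 3, {v : Fin 3 → ℂ | v i₀ = 1 ∧ ∀ i, bil (A i) v v = 0}.Finite by
    refine (Set.finite_iUnion H).subset ?_
    rintro v ⟨⟨i, hi⟩, hv⟩
    exact Set.mem_iUnion.2 ⟨i, hi, hv⟩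
  intro i₀
  by_contra hinf
  obtain ⟨w, hw, hwc⟩ := hK _ hinf
  have hw1 : w i₀ = 1 := by
    have := hw (MvPolynomial.X i₀ - 1) (by rintro b ⟨hb, -⟩; simp [hb])
    simpa [sub_eq_zero] using this
  have hwA : ∀ i, bil (fun j k => κ (A i j k)) w w = 0 := by
    intro i
    rw [← eval₂_bil]
    exact hw _ fun b hb => by rw [eval_bil, hb.2]
  obtain ⟨j, hj, v, hvj, hv⟩ := exists_max (x := w) (i := i₀) (by simp [hw1])
  obtain ⟨w', hw'⟩ : ∃ w' : Fin 3 → K, w' = fun k => (w j)⁻¹ * w k := ⟨_, rfl⟩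
  have hw'A : ∀ i, bil (fun j k => κ (A i j k)) w' w' = 0 := by
    intro i
    rw [hw', bil_smul_smul, hwA, mul_zero]
  have hw'v : ∀ k, Lim (w' k) (v k) := fun k => by simpa [hw', mul_comm] using hv k
  have hw'j : w' j = 1 := by simp [hw', hj]
  have hvA : ∀ i, bil (A i) v v = 0 := fun i =>
    lim_unique (lim_bil (A i) hw'v hw'v) (by rw [hw'A]; exact lim_zero)
  obtain ⟨m₀, hm₀⟩ : ∃ m, w' m - κ (v m) ≠ 0 := by
    by_contra! hall
    have hww : ∀ k, w k = w j * κ (v k) := fun k => by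
      rw [← sub_eq_zero.1 (hall k), hw']
      field_simp
    have hvi : v i₀ ≠ 0 := by
      intro h
      have := hww i₀
      simp [h, hw1] at this
    have hwj : w j = κ (v i₀)⁻¹ := by
      have := hww i₀
      rw [hw1] at this
      rw [map_inv₀]
      exact eq_inv_of_mul_eq_one_left this.symm
    refine hwc (fun k => (v i₀)⁻¹ * v k) (funext fun k => ?_)
    rw [hww k, hwj, map_mul]
  obtain ⟨m, hm, u, hum, hu⟩ := exists_max (x := fun k => w' k - κ (v k)) hm₀
  obtain ⟨e, he⟩ : ∃ e : K, e = w' m - κ (v m) := ⟨_, rfl⟩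
  obtain ⟨z, hz⟩ : ∃ z : Fin 3 → K, z = fun k => (w' k - κ (v k)) * (w' m - κ (v m))⁻¹ :=
    ⟨_, rfl⟩
  have hzu : ∀ k, Lim (z k) (u k) := by
    rw [hz]
    exact hu
  rw [← he] at hm hz
  have he0 : Lim e 0 := by
    rw [he]
    simpa using lim_sub (hw'v m) (lim_cst (K := K) (v m))
  have huj : u j = 0 := by
    have h1 : v j = 1 := hvj
    have := hzu j
    rw [hz] at this
    simp only [hw'j, h1, map_one, sub_self, zero_mul] at this
    exact lim_unique this lim_zero
  have hwz : w' = fun k => κ (v k) + e * z k := by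
    ext k
    rw [hz]
    field_simp
    ring
  have hpolar : ∀ i, bil (A i) v u + bil (A i) u v = 0 := by
    intro i
    have hexp : bil (fun j k => κ (A i j k)) w' w' = κ (bil (A i) v v)
        + e * (bil (fun j k => κ (A i j k)) (fun k => κ (v k)) z
          + bil (fun j k => κ (A i j k)) z (fun k => κ (v k))
          + e * bil (fun j k => κ (A i j k)) z z) := by
      rw [hwz]
      simp [bil, Fin.sum_univ_three]
      ring
    rw [hw'A, hvA, map_zero, zero_add, eq_comm, mul_eq_zero, or_iff_right hm] at hexp
    have hcv : ∀ k, Lim (κ (v k)) (v k) := fun k => lim_cst (v k)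
    have := lim_add (lim_add (lim_bil (A i) hcv hzu) (lim_bil (A i) hzu hcv))
      (lim_mul he0 (lim_bil (A i) hzu hzu))
    rw [hexp, zero_mul, add_zero] at this
    exact lim_unique this lim_zero
  have hcross := hA v u hvA hpolar
  rw [cross_apply] at hcross
  have c0 := congrFun hcross 0
  have c1 := congrFun hcross 1
  have c2 := congrFun hcross 2
  simp only [Matrix.cons_val, Pi.zero_apply] at c0 c1 c2
  have key : v j * u m = v m * u j := by
    fin_cases j <;> fin_cases m <;> simp at * <;> grind
  rw [hvj, hum, huj, mul_zero, mul_one] at key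
  exact one_ne_zero key

/-- The asymptotic set of a quadratic mapping whose values do not lie on a parametrized surface
lies on finitely many surfaces of degree at most two. -/
theorem infSet_quad (hK : HasGenericPoints K) {A : Fin 3 → Fin 3 → Fin 3 → ℂ}
    {b : Fin 3 → Fin 3 → ℂ} {c : Fin 3 → ℂ} (hnd : NotOnSurface (quad (K := K) A b c)) :
    QuadricCovered (infSet (quad (K := K) A b c)) := by
  by_cases hA : ∀ v u, (∀ i, bil (A i) v v = 0) → (∀ i, bil (A i) v u + bil (A i) u v = 0) →
      crossProduct v u = 0
  · refine (biUnion (I := Set.univ ×ˢ zeroSet A) (Set.finite_univ.prod (zeroSet_finite hK hA))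
      (S := fun p => {a | p.2 p.1 = 1 ∧ ∃ x : Fin 3 → K, Infinite' (x p.1) ∧
        (∀ j, Lim (x j * (x p.1)⁻¹) (p.2 j)) ∧ ∀ j, Lim (quad A b c x j) (a j)}) ?_).mono ?_
    · rintro ⟨i, v⟩ ⟨-, -, hv⟩
      by_cases hi : v i = 1
      · exact (of_nondegenerate_zero A b c hi hv fun u => hA v u hv).mono fun a ha => ha.2
      · exact empty.mono fun a ha => absurd ha.1 hi
    · rintro a ⟨x, hx, ha⟩
      obtain ⟨j, hj, v, hvj, hv, hvA⟩ := exists_direction hx ha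
      exact Set.mem_biUnion (x := (j, v)) ⟨trivial, ⟨j, hvj⟩, hvA⟩ ⟨hvj, x, hj, hv, ha⟩
  · push Not at hA
    obtain ⟨v, u, hv, hu, hvu⟩ := hA
    exact of_degenerate_zero A b c hnd hvu hv hu

end QuadricCovered

section Polynomials

open MvPolynomial

/-- The polynomial of degree at most two with the given coefficients. -/
noncomputable def quadPoly (A : Fin 3 → Fin 3 → ℂ) (b : Fin 3 → ℂ) (c : ℂ) :
    MvPolynomial (Fin 3) ℂ :=
  bil (fun j k => C (A j k)) X X + ∑ j, C (b j) * X j + C c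

lemma quadPoly_add (A A' : Fin 3 → Fin 3 → ℂ) (b b' : Fin 3 → ℂ) (c c' : ℂ) :
    quadPoly A b c + quadPoly A' b' c' = quadPoly (A + A') (b + b') (c + c') := by
  simp [quadPoly, bil, Fin.sum_univ_three]
  ring

lemma exists_quadPoly_monomial (d : Fin 3 →₀ ℕ) (r : ℂ) (hd : d.degree ≤ 2) :
    ∃ A b c, monomial d r = quadPoly A b c := by
  have split : ∀ e : Fin 3 →₀ ℕ, e ≠ 0 →
      ∃ (i : Fin 3) (e' : Fin 3 →₀ ℕ), e = e' + Finsupp.single i 1 := by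
    intro e he
    obtain ⟨i, hi⟩ := Finsupp.ne_iff.1 he
    refine ⟨i, e - Finsupp.single i 1, ?_⟩
    rw [tsub_add_cancel_of_le]
    simpa [Nat.one_le_iff_ne_zero] using hi
  have hmon : ∀ (e : Fin 3 →₀ ℕ) (i : Fin 3),
      monomial (e + Finsupp.single i 1) r = monomial e r * (X i : MvPolynomial (Fin 3) ℂ) := by
    intro e i
    rw [X, monomial_mul, mul_one]
  rcases eq_or_ne d 0 with rfl | h0
  · exact ⟨0, 0, r, by rw [← C_apply]; simp [quadPoly, bil]⟩
  obtain ⟨i, e, rfl⟩ := split d h0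
  rcases eq_or_ne e 0 with rfl | h1
  · refine ⟨0, Pi.single i r, 0, ?_⟩
    rw [hmon, ← C_apply]
    simp [quadPoly, bil, Pi.single_apply, apply_ite C]
  obtain ⟨j, e', rfl⟩ := split e h1
  have he' : e' = 0 := by
    simpa [Finsupp.degree_eq_zero_iff] using hd
  subst he'
  refine ⟨Pi.single j (Pi.single i r), 0, 0, ?_⟩
  rw [hmon, hmon, ← C_apply]
  simp [quadPoly, bil, Pi.single_apply, apply_ite C, ite_apply]

lemma exists_eq_quadPoly {p : MvPolynomial (Fin 3) ℂ} (hp : p.totalDegree ≤ 2) :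
    ∃ A b c, p = quadPoly A b c := by
  have H : ∀ s ⊆ p.support, ∃ A b c, ∑ d ∈ s, monomial d (coeff d p) = quadPoly A b c := by
    intro s
    induction s using Finset.induction_on with
    | empty => exact fun _ => ⟨0, 0, 0, by simp [quadPoly, bil]⟩
    | insert d s hd ih =>
      intro hs
      obtain ⟨A, b, c, h⟩ := ih fun e he => hs (Finset.mem_insert_of_mem he)
      obtain ⟨A', b', c', h'⟩ := exists_quadPoly_monomial d (coeff d p)
        ((le_totalDegree (hs (Finset.mem_insert_self d s))).trans hp)
      exact ⟨_, _, _, by rw [Finset.sum_insert hd, h, h', quadPoly_add]⟩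
  obtain ⟨A, b, c, h⟩ := H _ subset_rfl
  exact ⟨A, b, c, by rw [← h, support_sum_monomial_coeff]⟩

lemma eval₂_quadPoly {K : Type} [LimitField K] (A : Fin 3 → Fin 3 → Fin 3 → ℂ)
    (b : Fin 3 → Fin 3 → ℂ) (c : Fin 3 → ℂ) (x : Fin 3 → K) (i : Fin 3) :
    (quadPoly (A i) (b i) (c i)).eval₂ cst x = QuadricCovered.quad A b c x i := by
  simp [quadPoly, QuadricCovered.quad, bil, Fin.sum_univ_three]

lemma exists_relation (G : Fin 3 → MvPolynomial (Fin 2) ℂ) :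
    ∃ R : MvPolynomial (Fin 3) ℂ, R ≠ 0 ∧ aeval G R = 0 := by
  by_contra! h
  have hG : AlgebraicIndependent ℂ G := by
    rw [algebraicIndependent_iff]
    intro R hR
    by_contra h0
    exact h R h0 hR
  have := hG.lift_cardinalMk_le_trdeg
  rw [MvPolynomial.trdeg_of_isDomain] at this
  norm_num at this

lemma notOnSurface_of_dense {K : Type} [LimitField K] {P : Fin 3 → MvPolynomial (Fin 3) ℂ}
    (hP : Dense (Set.range fun x i => eval x (P i))) :
    NotOnSurface fun (x : Fin 3 → K) i => (P i).eval₂ cst x := by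
  intro G hG
  obtain ⟨R, hR0, hR⟩ := exists_relation G
  have hval : ∀ x : Fin 3 → ℂ, eval (fun i => eval x (P i)) R = 0 := by
    intro x
    obtain ⟨s, hs⟩ := hG fun i => cst (K := K) (x i)
    rw [← cst_eq_zero (K := K)]
    have h1 : ∀ p (y : Fin 3 → ℂ), cst (K := K) (eval y p) = p.eval₂ cst fun i => cst (K := K) (y i) := by
      intro p y
      rw [eval, coe_eval₂Hom, eval₂_comp_left, RingHom.comp_id]
      rfl
    rw [h1]
    simp only [h1, hs]
    have h2 := congrArg (eval₂ (cst (K := K)) s) hR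
    rw [eval₂_zero, aeval_def, ← coe_eval₂Hom, hom_eval₂] at h2
    have hc : (eval₂Hom (cst (K := K)) s).comp (algebraMap ℂ (MvPolynomial (Fin 2) ℂ)) = cst := by
      ext r
      simp
    rwa [hc] at h2
  have hall : ∀ y, eval y R = 0 := by
    have hclosed : IsClosed {y | eval y R = 0} :=
      isClosed_eq (MvPolynomial.continuous_eval R) continuous_const
    intro y
    have := hclosed.closure_subset_iff.2 (Set.range_subset_iff.2 hval)
    exact this (hP y)
  exact hR0 (MvPolynomial.funext fun y => by simp [hall])

end Polynomials

section Germs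

/-- The field of germs of complex sequences along an ultrafilter. -/
abbrev SeqGerm : Type := Germ (hyperfilter ℕ : Filter ℕ) ℂ

lemma tendsto_or_inv_tendsto (f : ℕ → ℂ) :
    (∃ a, Tendsto f (hyperfilter ℕ) (𝓝 a)) ∨
      Tendsto (fun n => (f n)⁻¹) (hyperfilter ℕ : Filter ℕ) (𝓝 0) := by
  by_cases h : ∃ R, Metric.closedBall (0 : ℂ) R ∈ (hyperfilter ℕ).map f
  · obtain ⟨R, hR⟩ := h
    obtain ⟨a, -, ha⟩ := (isCompact_closedBall (0 : ℂ) R).ultrafilter_le_nhds _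
      (le_principal_iff.2 hR)
    exact Or.inl ⟨a, ha⟩
  · push Not at h
    refine Or.inr (tendsto_inv₀_cobounded.comp ?_)
    rw [(Metric.hasBasis_cobounded_compl_closedBall (0 : ℂ)).tendsto_right_iff]
    intro R _
    exact Ultrafilter.compl_mem_iff_notMem.2 (h R)

noncomputable instance : LimitField SeqGerm where
  __ := (inferInstance : Field SeqGerm)
  cst := (Germ.coeRingHom _).comp (Pi.constRingHom ℕ ℂ)
  Lim x a := x.Tendsto (𝓝 a)
  lim_cst c := tendsto_const_nhds
  lim_add {x y a b} hx hy := by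
    induction x, y using Germ.inductionOn₂
    exact Tendsto.add hx hy
  lim_mul {x y a b} hx hy := by
    induction x, y using Germ.inductionOn₂
    exact Tendsto.mul hx hy
  lim_unique {x a b} ha hb := by
    induction x using Germ.inductionOn
    exact tendsto_nhds_unique ha hb
  lim_or_inv x := by
    by_cases hx : ∃ a : ℂ, x.Tendsto (𝓝 a)
    · exact Or.inl hx
    · refine Or.inr ⟨?_, ?_⟩
      · rintro rfl
        exact hx ⟨0, tendsto_const_nhds⟩
      · induction x using Germ.inductionOn with
        | _ f => exact (tendsto_or_inv_tendsto f).resolve_left hx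

/-- The point with coordinates in germs given by a sequence of points. -/
noncomputable def seqPoint (ξ : ℕ → Fin 3 → ℂ) (i : Fin 3) : SeqGerm := ((fun n => ξ n i : ℕ → ℂ) : SeqGerm)

lemma eval₂_seqPoint (ξ : ℕ → Fin 3 → ℂ) (p : MvPolynomial (Fin 3) ℂ) :
    p.eval₂ cst (seqPoint ξ) = ((fun n => p.eval (ξ n) : ℕ → ℂ) : SeqGerm) := by
  induction p using MvPolynomial.induction_on with
  | C a => simp; rfl
  | add p q hp hq => simp [hp, hq]; rfl
  | mul_X p i hp => simp [hp, seqPoint]; rfl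

lemma hasGenericPoints_seqGerm : HasGenericPoints SeqGerm := by
  intro B hB
  refine ⟨seqPoint fun n => hB.natEmbedding B n, fun p hp => ?_, fun v hv => ?_⟩
  · rw [eval₂_seqPoint]
    simp only [fun n => hp _ (hB.natEmbedding B n).2]
    rfl
  · have h : ∀ i, ∀ᶠ n in (hyperfilter ℕ : Filter ℕ), (hB.natEmbedding B n : Fin 3 → ℂ) i = v i :=
      fun i => Germ.coe_eq.1 (congrFun hv i)
    refine notMem_hyperfilter_of_finite (s := {n | (hB.natEmbedding B n : Fin 3 → ℂ) = v})
      (Set.Subsingleton.finite fun m hm n hn => ?_) ?_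
    · exact (hB.natEmbedding B).injective (Subtype.ext (hm.trans hn.symm))
    · filter_upwards [eventually_all.2 h] with n hn using funext hn

lemma asymptoticSet_subset {P : Fin 3 → MvPolynomial (Fin 3) ℂ} {F : (Fin 3 → ℂ) → Fin 3 → ℂ}
    (hF : ∀ x i, F x i = (P i).eval x) :
    asymptoticSet F ⊆ infSet fun (x : Fin 3 → SeqGerm) i => (P i).eval₂ cst x := by
  rintro a ⟨ξ, hξ, ha⟩
  refine ⟨seqPoint ξ, fun hfin => ?_, fun i => ?_⟩
  · choose b hb using hfin
    have hb' : Tendsto ξ (hyperfilter ℕ) (𝓝 b) := tendsto_pi_nhds.2 hb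
    exact not_tendsto_nhds_of_tendsto_atTop (hξ.mono_left Nat.hyperfilter_le_atTop) _ hb'.norm
  · simp only [eval₂_seqPoint, ← hF]
    exact (tendsto_pi_nhds.1 ha i).mono_left Nat.hyperfilter_le_atTop

end Germs

end

/-- Any irreducible nonconstant polynomial whose zero set is contained in the asymptotic set
of a non-proper dominant degree-2 polynomial mapping `F : ℂ³ → ℂ³` has total degree 1 or 2. -/
theorem component_degree_le_two
    (P : Fin 3 → MvPolynomial (Fin 3) ℂ) (F : (Fin 3 → ℂ) → (Fin 3 → ℂ))
    (hP : IsDegTwoPolyMap P F)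
    (hdom : Dense (Set.range F))
    (hne : asymptoticSet F ≠ ∅)
    (Q : MvPolynomial (Fin 3) ℂ) (hQirr : Irreducible Q) (hQdeg : 0 < Q.totalDegree)
    (hQsub : {x | MvPolynomial.eval x Q = 0} ⊆ asymptoticSet F) :
    1 ≤ Q.totalDegree ∧ Q.totalDegree ≤ 2 := by
  obtain ⟨hF, hdeg, -⟩ := hP
  choose A b c hPA using fun i => exists_eq_quadPoly (hdeg i)
  obtain rfl : F = fun x i => MvPolynomial.eval x (P i) := funext fun x => funext (hF x)
  have hquad : (fun (x : Fin 3 → SeqGerm) i => (P i).eval₂ LimitField.cst x) =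
      QuadricCovered.quad A b c := by
    funext x i
    rw [← eval₂_quadPoly, ← hPA]
  have hnd := notOnSurface_of_dense (K := SeqGerm) hdom
  have hsub := asymptoticSet_subset hF
  rw [hquad] at hnd hsub
  exact ⟨hQdeg, ((QuadricCovered.infSet_quad hasGenericPoints_seqGerm hnd).mono hsub).totalDegree_le
    hQirr hQsub⟩
end

section
/- Let F : ℂ³ → ℂ³ be a dominant polynomial mapping of degree 2 with S_F ≠ ∅. Then S_F cannot simultaneously contain a paraboloid and two distinct planes. -/
open Filter Topology

/-- The finite set of exponents of total degree at most `D`. -/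
noncomputable def exponentsLE (n D : ℕ) : Finset (Fin n →₀ ℕ) :=
  (Finsupp.finite_of_degree_le (σ := Fin n) D).toFinset

lemma mem_exponentsLE {n D : ℕ} {s : Fin n →₀ ℕ} : s ∈ exponentsLE n D ↔ s.degree ≤ D := by
  simp [exponentsLE]

/-- The `d`-adic deformation of the monomial `X ^ s`: each factor `X i ^ d` of `X ^ s` is
replaced by `h i`. -/
noncomputable def deformedMonomial {R : Type*} [CommRing R] {n : ℕ} (d : ℕ)
    (h : Fin n → MvPolynomial (Fin n) R) (s : Fin n →₀ ℕ) : MvPolynomial (Fin n) R :=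
  ∏ i, (MvPolynomial.X i ^ (s i % d) * h i ^ (s i / d))

/-- The coefficients of the deformed monomials of degree at most `D`. -/
noncomputable def deformationMatrix {R : Type*} [CommRing R] {n : ℕ} (d : ℕ)
    (h : Fin n → MvPolynomial (Fin n) R) (D : ℕ) :
    Matrix (exponentsLE n D) (exponentsLE n D) R :=
  Matrix.of fun s t => (deformedMonomial d h s).coeff t

lemma totalDegree_deformedMonomial_le {R : Type*} [CommRing R] {n d : ℕ}
    {h : Fin n → MvPolynomial (Fin n) R} (hdeg : ∀ i, (h i).totalDegree ≤ d)
    (s : Fin n →₀ ℕ) : (deformedMonomial d h s).totalDegree ≤ s.degree := by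
  rw [Finsupp.degree_eq_sum]
  refine (MvPolynomial.totalDegree_finsetProd _ _).trans (Finset.sum_le_sum fun i _ => ?_)
  calc (MvPolynomial.X i ^ (s i % d) * h i ^ (s i / d)).totalDegree
      ≤ (MvPolynomial.X i ^ (s i % d) : MvPolynomial (Fin n) R).totalDegree
        + (h i ^ (s i / d)).totalDegree := MvPolynomial.totalDegree_mul _ _
    _ ≤ s i % d + (s i / d) * d := by
        gcongr
        · rw [MvPolynomial.X_pow_eq_monomial]
          exact (MvPolynomial.totalDegree_monomial_le _ _).trans (by simp)
        · exact (MvPolynomial.totalDegree_pow _ _).trans (Nat.mul_le_mul_left _ (hdeg i))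
    _ = s i := Nat.mod_add_div' _ _

lemma coeff_eq_zero_of_totalDegree_lt_degree {R : Type*} [CommRing R] {n : ℕ}
    {p : MvPolynomial (Fin n) R} {t : Fin n →₀ ℕ} (ht : p.totalDegree < t.degree) :
    p.coeff t = 0 :=
  MvPolynomial.coeff_eq_zero_of_totalDegree_lt ht

lemma exists_eq_sum_deformedMonomial {K : Type*} [Field K] {n d : ℕ}
    {h : Fin n → MvPolynomial (Fin n) K} (hdeg : ∀ i, (h i).totalDegree ≤ d) {D : ℕ}
    (hdet : (deformationMatrix d h D).det ≠ 0) {p : MvPolynomial (Fin n) K}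
    (hp : p.totalDegree ≤ D) :
    ∃ c : (Fin n →₀ ℕ) → K,
      p = ∑ s ∈ exponentsLE n D, MvPolynomial.C (c s) * deformedMonomial d h s := by
  set A := deformationMatrix d h D
  set c : exponentsLE n D → K := Matrix.vecMul (fun t : exponentsLE n D => p.coeff t) A⁻¹ with hc
  have hcA : Matrix.vecMul c A = fun t : exponentsLE n D => p.coeff t := by
    rw [hc, Matrix.vecMul_vecMul, Matrix.nonsing_inv_mul _ (isUnit_iff_ne_zero.mpr hdet),
      Matrix.vecMul_one]
  refine ⟨fun s => if hs : s ∈ exponentsLE n D then c ⟨s, hs⟩ else 0, ?_⟩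
  ext t
  rw [MvPolynomial.coeff_sum]
  simp_rw [MvPolynomial.coeff_C_mul]
  by_cases ht : t ∈ exponentsLE n D
  · have := congrFun hcA ⟨t, ht⟩
    simp only at this
    rw [← this, ← Finset.sum_coe_sort (exponentsLE n D)]
    simp [Matrix.vecMul, dotProduct, A, deformationMatrix]
  · rw [mem_exponentsLE, not_le] at ht
    rw [coeff_eq_zero_of_totalDegree_lt_degree (hp.trans_lt ht), Finset.sum_eq_zero]
    intro s hs
    rw [coeff_eq_zero_of_totalDegree_lt_degree, mul_zero]
    exact ((totalDegree_deformedMonomial_le hdeg s).trans (mem_exponentsLE.mp hs)).trans_lt ht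

lemma map_deformedMonomial {R S : Type*} [CommRing R] [CommRing S] (φ : R →+* S) {n : ℕ} (d : ℕ)
    (h : Fin n → MvPolynomial (Fin n) R) (s : Fin n →₀ ℕ) :
    MvPolynomial.map φ (deformedMonomial d h s) =
      deformedMonomial d (fun i => MvPolynomial.map φ (h i)) s := by
  simp [deformedMonomial]

lemma map_deformationMatrix {R S : Type*} [CommRing R] [CommRing S] (φ : R →+* S) {n : ℕ} (d : ℕ)
    (h : Fin n → MvPolynomial (Fin n) R) (D : ℕ) :
    φ.mapMatrix (deformationMatrix d h D) =
      deformationMatrix d (fun i => MvPolynomial.map φ (h i)) D := by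
  ext s t
  simp [deformationMatrix, ← map_deformedMonomial, MvPolynomial.coeff_map]

lemma deformationMatrix_X_pow {R : Type*} [CommRing R] {n : ℕ} (d D : ℕ) :
    deformationMatrix d (fun i : Fin n => (MvPolynomial.X i ^ d : MvPolynomial (Fin n) R)) D
      = 1 := by
  ext s t
  have : deformedMonomial d (fun i : Fin n => (MvPolynomial.X i ^ d : MvPolynomial (Fin n) R)) s
      = MvPolynomial.monomial s 1 := by
    simp_rw [deformedMonomial, ← pow_mul, ← pow_add, Nat.mod_add_div]
    rw [MvPolynomial.monomial_eq, Finsupp.prod_fintype _ _ (by simp)]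
    simp
  rw [deformationMatrix, Matrix.of_apply, this, MvPolynomial.coeff_monomial, Matrix.one_apply]
  simp only [Subtype.ext_iff]

/-- For all but finitely many `τ`, the deformed monomials of degree at most `D` attached to the
pencil `X i ^ d + τ * f i` are linearly independent. -/
lemma finite_setOf_det_deformationMatrix_eq_zero {K : Type*} [Field K] {n : ℕ} (d D : ℕ)
    (f : Fin n → MvPolynomial (Fin n) K) :
    {τ : K | (deformationMatrix d
      (fun i => MvPolynomial.X i ^ d + MvPolynomial.C τ * f i) D).det = 0}.Finite := by
  set A := deformationMatrix d (fun i => MvPolynomial.X i ^ d +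
    MvPolynomial.C Polynomial.X * MvPolynomial.map Polynomial.C (f i)) D with hA
  have key : ∀ τ : K, A.det.eval τ = (deformationMatrix d
      (fun i => MvPolynomial.X i ^ d + MvPolynomial.C τ * f i) D).det := by
    intro τ
    have : (Polynomial.evalRingHom τ).comp Polynomial.C = RingHom.id K := by ext; simp
    rw [← Polynomial.coe_evalRingHom, RingHom.map_det, hA, map_deformationMatrix]
    simp [MvPolynomial.map_map, this, MvPolynomial.map_id]
  have h0 : A.det ≠ 0 := by
    intro h
    have := key 0
    simp [h, deformationMatrix_X_pow] at this
  classical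
  refine (A.det.roots.toFinset.finite_toSet).subset fun τ hτ => ?_
  rw [Set.mem_ofPred_eq] at hτ
  simp [h0, key, hτ]

/-- `Φ ∈ R[Y]`, with `R` a polynomial ring, has weighted degree at most `D` when the variables
of `R` have weight `d` and `Y` has weight one. -/
def WeightLE {n : ℕ} {K : Type*} [CommRing K] (d : ℕ) (D : ℤ)
    (Φ : Polynomial (MvPolynomial (Fin n) K)) : Prop :=
  ∀ j m, (Φ.coeff j).coeff m ≠ 0 → (d * m.degree + j : ℤ) ≤ D

namespace WeightLE

variable {n : ℕ} {K : Type*} [CommRing K] {d : ℕ}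

lemma zero (D : ℤ) : WeightLE d D (0 : Polynomial (MvPolynomial (Fin n) K)) := by
  intro j m h
  simp at h

lemma add {D : ℤ} {Φ Ψ : Polynomial (MvPolynomial (Fin n) K)} (hΦ : WeightLE d D Φ)
    (hΨ : WeightLE d D Ψ) : WeightLE d D (Φ + Ψ) := by
  intro j m h
  by_contra hD
  apply h
  rw [Polynomial.coeff_add, MvPolynomial.coeff_add, not_not.mp (mt (hΦ j m) hD),
    not_not.mp (mt (hΨ j m) hD), add_zero]

lemma neg {D : ℤ} {Φ : Polynomial (MvPolynomial (Fin n) K)} (hΦ : WeightLE d D Φ) :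
    WeightLE d D (-Φ) := by
  intro j m h
  exact hΦ j m (by simpa using h)

lemma sum {ι : Type*} {D : ℤ} {s : Finset ι} {Φ : ι → Polynomial (MvPolynomial (Fin n) K)}
    (hΦ : ∀ i ∈ s, WeightLE d D (Φ i)) : WeightLE d D (∑ i ∈ s, Φ i) :=
  Finset.sum_induction _ _ (fun _ _ => add) (zero D) hΦ

lemma mul {D E : ℤ} {Φ Ψ : Polynomial (MvPolynomial (Fin n) K)} (hΦ : WeightLE d D Φ)
    (hΨ : WeightLE d E Ψ) : WeightLE d (D + E) (Φ * Ψ) := by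
  intro j m h
  rw [Polynomial.coeff_mul, MvPolynomial.coeff_sum] at h
  obtain ⟨⟨a, b⟩, hab, h⟩ := Finset.exists_ne_zero_of_sum_ne_zero h
  rw [MvPolynomial.coeff_mul] at h
  obtain ⟨⟨u, v⟩, huv, h⟩ := Finset.exists_ne_zero_of_sum_ne_zero h
  rw [Finset.HasAntidiagonal.mem_antidiagonal] at hab huv
  simp only at hab huv h
  have h₁ := hΦ a u (left_ne_zero_of_mul h)
  have h₂ := hΨ b v (right_ne_zero_of_mul h)
  rw [← hab, ← huv, map_add]
  push_cast
  linarith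

lemma one : WeightLE d 0 (1 : Polynomial (MvPolynomial (Fin n) K)) := by
  intro j m h
  rw [Polynomial.coeff_one] at h
  split_ifs at h with hj
  · rw [MvPolynomial.coeff_one] at h
    split_ifs at h with hm
    · simp [hj, ← hm]
    · simp at h
  · simp at h

lemma X : WeightLE d 1 (Polynomial.X : Polynomial (MvPolynomial (Fin n) K)) := by
  intro j m h
  rw [Polynomial.coeff_X] at h
  split_ifs at h with hj
  · rw [MvPolynomial.coeff_one] at h
    split_ifs at h with hm
    · simp [← hj, ← hm]
    · simp at h
  · simp at h

lemma C_monomial {D : ℤ} {m : Fin n →₀ ℕ} (hm : (d * m.degree : ℤ) ≤ D) (c : K) :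
    WeightLE d D (Polynomial.C (MvPolynomial.monomial m c)) := by
  intro j m' h
  rw [Polynomial.coeff_C] at h
  split_ifs at h with hj
  · rw [MvPolynomial.coeff_monomial] at h
    split_ifs at h with hm'
    · simpa [hj, ← hm'] using hm
    · simp at h
  · simp at h

lemma prod {ι : Type*} {D : ι → ℤ} (s : Finset ι)
    {Φ : ι → Polynomial (MvPolynomial (Fin n) K)} (hΦ : ∀ i ∈ s, WeightLE d (D i) (Φ i)) :
    WeightLE d (∑ i ∈ s, D i) (∏ i ∈ s, Φ i) := by
  classical
  induction s using Finset.induction_on with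
  | empty => simpa using one
  | insert a s ha ih =>
    rw [Finset.sum_insert ha, Finset.prod_insert ha]
    exact (hΦ a (Finset.mem_insert_self a s)).mul
      (ih fun i hi => hΦ i (Finset.mem_insert_of_mem hi))

/-- If the entries of a matrix have weighted degree bounded by `1 + w i - w j`, its determinant
has weighted degree at most the size of the matrix. -/
lemma det {ι : Type*} [Fintype ι] [DecidableEq ι] (w : ι → ℤ)
    {M : Matrix ι ι (Polynomial (MvPolynomial (Fin n) K))}
    (hM : ∀ i j, WeightLE d (1 + w i - w j) (M i j)) : WeightLE d (Fintype.card ι) M.det := by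
  rw [Matrix.det_apply]
  refine sum fun g _ => ?_
  have h := prod (D := fun i => 1 + w (g i) - w i) Finset.univ fun i _ => hM (g i) i
  have hsum : ∑ i, (1 + w (g i) - w i) = (Fintype.card ι : ℤ) := by
    rw [Finset.sum_sub_distrib, Finset.sum_add_distrib, Equiv.sum_comp g w]
    simp
  rw [hsum] at h
  rcases Int.units_eq_one_or (Equiv.Perm.sign g) with hg | hg
  · simpa [hg] using h
  · simpa [hg] using h.neg

end WeightLE

/-- The **Perron theorem** for polynomials of degree `d` whose deformed monomials are linearly
independent in each degree. -/
lemma exists_relation_of_det_ne_zero {K : Type*} [Field K] {n d : ℕ} (hd : 0 < d)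
    {h : Fin n → MvPolynomial (Fin n) K} (hdeg : ∀ i, (h i).totalDegree ≤ d)
    (hdet : ∀ D, (deformationMatrix d h D).det ≠ 0) {l : MvPolynomial (Fin n) K}
    (hl : l.totalDegree ≤ 1) :
    ∃ Φ : Polynomial (MvPolynomial (Fin n) K), Φ ≠ 0 ∧ WeightLE d (d ^ n : ℕ) Φ ∧
      Φ.eval₂ (MvPolynomial.aeval h : MvPolynomial (Fin n) K →ₐ[K] _).toRingHom l = 0 := by
  classical
  set v : (Fin n → Fin d) → MvPolynomial (Fin n) K :=
    fun e => ∏ i, MvPolynomial.X i ^ (e i : ℕ) with hv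
  set w : (Fin n → Fin d) → ℕ := fun e => ∑ i, (e i : ℕ) with hw
  have hvdeg : ∀ e, (v e).totalDegree ≤ w e := fun e =>
    (MvPolynomial.totalDegree_finsetProd _ _).trans (Finset.sum_le_sum fun i _ => by
      rw [MvPolynomial.X_pow_eq_monomial]
      exact (MvPolynomial.totalDegree_monomial_le _ _).trans (by simp))
  have hlv : ∀ e, (l * v e).totalDegree ≤ 1 + w e := fun e =>
    (MvPolynomial.totalDegree_mul _ _).trans (add_le_add hl (hvdeg e))
  choose c hc using fun e => exists_eq_sum_deformedMonomial hdeg (hdet (1 + w e)) (hlv e)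
  set r : (Fin n →₀ ℕ) → (Fin n → Fin d) := fun s i => ⟨s i % d, Nat.mod_lt _ hd⟩ with hr
  set q : (Fin n →₀ ℕ) → (Fin n →₀ ℕ) :=
    fun s => s.mapRange (· / d) (Nat.zero_div d) with hq
  set Q : Matrix (Fin n → Fin d) (Fin n → Fin d) (MvPolynomial (Fin n) K) :=
    Matrix.of fun e e' => ∑ s ∈ exponentsLE n (1 + w e) with r s = e',
      MvPolynomial.monomial (q s) (c e s) with hQ
  have hmul : ∀ e, l * v e = ∑ e', MvPolynomial.aeval h (Q e e') * v e' := by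
    intro e
    rw [hc e, ← Finset.sum_fiberwise _ r]
    refine Finset.sum_congr rfl fun e' _ => ?_
    rw [hQ, Matrix.of_apply, map_sum, Finset.sum_mul]
    refine Finset.sum_congr rfl fun s hs => ?_
    rw [← (Finset.mem_filter.mp hs).2, MvPolynomial.aeval_monomial,
      Finsupp.prod_fintype _ _ (by simp), deformedMonomial, Finset.prod_mul_distrib]
    simp only [hv, hr, hq, Finsupp.mapRange_apply, MvPolynomial.algebraMap_eq]
    ring
  have hweight : ∀ e e', WeightLE d (1 + w e - w e') (Q.charmatrix e e') := by
    intro e e'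
    rw [Matrix.charmatrix_apply, sub_eq_add_neg]
    refine WeightLE.add ?_ (WeightLE.neg ?_)
    · rw [Matrix.diagonal_apply]
      split_ifs with hee
      · simpa [hee] using WeightLE.X
      · exact WeightLE.zero _
    · rw [hQ, Matrix.of_apply, map_sum]
      refine WeightLE.sum fun s hs => WeightLE.C_monomial ?_ _
      obtain ⟨hs, hse⟩ := Finset.mem_filter.mp hs
      have hsdeg := mem_exponentsLE.mp hs
      have : s.degree = w e' + d * (q s).degree := by
        rw [← hse, Finsupp.degree_eq_sum, Finsupp.degree_eq_sum, Finset.mul_sum, hw,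
          ← Finset.sum_add_distrib]
        refine Finset.sum_congr rfl fun i _ => ?_
        simp [hr, hq, Nat.mod_add_div]
      have h₂ : w e' + d * (q s).degree ≤ 1 + w e := this ▸ hsdeg
      zify at h₂
      linarith
  refine ⟨Q.charpoly, (Matrix.charpoly_monic Q).ne_zero, ?_, ?_⟩
  · have := WeightLE.det (fun e => (w e : ℤ)) hweight
    simpa [Matrix.charpoly] using this
  · set φ := Polynomial.eval₂RingHom
      (MvPolynomial.aeval h : MvPolynomial (Fin n) K →ₐ[K] MvPolynomial (Fin n) K).toRingHom l
      with hφ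
    change φ Q.charpoly = 0
    rw [Matrix.charpoly, RingHom.map_det, ← Matrix.exists_mulVec_eq_zero_iff]
    refine ⟨v, fun hv0 => ?_, ?_⟩
    · have := congrFun hv0 fun _ => ⟨0, hd⟩
      simp [hv] at this
    · ext1 e
      have hentry : ∀ e', φ (Q.charmatrix e e') =
          (if e = e' then l else 0) - MvPolynomial.aeval h (Q e e') := by
        intro e'
        rw [Matrix.charmatrix_apply, map_sub, Matrix.diagonal_apply]
        split_ifs <;> simp [hφ]
      simp only [Matrix.mulVec, dotProduct, RingHom.mapMatrix_apply, Matrix.map_apply, hentry,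
        sub_mul, Finset.sum_sub_distrib, ← hmul e]
      simp

/-- The weighted-degree bound is preserved under pointwise limits of relations. -/
lemma exists_relation_of_tendsto {n d : ℕ} (hd : 0 < d) {D : ℕ} {X : Type*}
    {v : ℕ → X → Fin n → ℂ} {v' : X → Fin n → ℂ} {y : X → ℂ}
    (hv : ∀ x, Tendsto (fun k => v k x) atTop (𝓝 (v' x)))
    (H : ∀ k, ∃ Φ : Polynomial (MvPolynomial (Fin n) ℂ), Φ ≠ 0 ∧ WeightLE d D Φ ∧
      ∀ x, Φ.eval₂ (MvPolynomial.eval (v k x)) (y x) = 0) :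
    ∃ Φ : Polynomial (MvPolynomial (Fin n) ℂ), Φ ≠ 0 ∧ WeightLE d D Φ ∧
      ∀ x, Φ.eval₂ (MvPolynomial.eval (v' x)) (y x) = 0 := by
  set J : Finset (ℕ × (Fin n →₀ ℕ)) :=
    (Finset.range (D + 1) ×ˢ exponentsLE n D).filter fun p => d * p.2.degree + p.1 ≤ D with hJ
  have memJ : ∀ p, p ∈ J ↔ d * p.2.degree + p.1 ≤ D := by
    intro p
    simp only [hJ, Finset.mem_filter, Finset.mem_product, Finset.mem_range, mem_exponentsLE,
      and_iff_right_iff_imp]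
    intro hp
    have := Nat.le_mul_of_pos_left p.2.degree hd
    omega
  set poly : (J → ℂ) → Polynomial (MvPolynomial (Fin n) ℂ) := fun c =>
    ∑ p : J, Polynomial.monomial p.1.1 (MvPolynomial.monomial p.1.2 (c p)) with hpoly
  have coeff_poly : ∀ (c : J → ℂ) (p : J), ((poly c).coeff p.1.1).coeff p.1.2 = c p := by
    intro c p
    rw [hpoly, Polynomial.finsetSum_coeff, MvPolynomial.coeff_sum, Finset.sum_eq_single p]
    · simp
    · intro p' _ hp'
      rw [Polynomial.coeff_monomial]
      split_ifs with h₁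
      · rw [MvPolynomial.coeff_monomial, if_neg]
        exact fun h₂ => hp' (Subtype.ext (Prod.ext h₁ h₂))
      · simp
    · simp
  have weight_poly : ∀ c, WeightLE d D (poly c) := by
    intro c j m hjm
    rw [hpoly, Polynomial.finsetSum_coeff, MvPolynomial.coeff_sum] at hjm
    obtain ⟨p, -, hp⟩ := Finset.exists_ne_zero_of_sum_ne_zero hjm
    rw [Polynomial.coeff_monomial] at hp
    split_ifs at hp with h₁
    · rw [MvPolynomial.coeff_monomial] at hp
      split_ifs at hp with h₂
      · have := (memJ p.1).mp p.2
        rw [h₁, h₂] at this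
        exact_mod_cast this
      · simp at hp
    · simp at hp
  have poly_eq : ∀ Φ, WeightLE d D Φ →
      poly (fun p => (Φ.coeff p.1.1).coeff p.1.2) = Φ := by
    intro Φ hΦ
    ext j m
    by_cases hjm : (j, m) ∈ J
    · exact coeff_poly _ ⟨(j, m), hjm⟩
    · have aux : ∀ Ψ : Polynomial (MvPolynomial (Fin n) ℂ), WeightLE d D Ψ →
          (Ψ.coeff j).coeff m = 0 := by
        intro Ψ hΨ
        by_contra h
        exact hjm ((memJ _).mpr (by exact_mod_cast hΨ j m h))
      rw [aux _ (weight_poly _), aux _ hΦ]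
  have eval_poly : ∀ (c : J → ℂ) (u : Fin n → ℂ) (z : ℂ),
      (poly c).eval₂ (MvPolynomial.eval u) z =
        ∑ p : J, c p * (∏ i, u i ^ p.1.2 i) * z ^ p.1.1 := by
    intro c u z
    rw [hpoly, Polynomial.eval₂_finsetSum]
    refine Finset.sum_congr rfl fun p _ => ?_
    rw [Polynomial.eval₂_monomial, MvPolynomial.eval_monomial, Finsupp.prod_fintype _ _ (by simp)]
  have Hc : ∀ k, ∃ c : J → ℂ, ‖c‖ = 1 ∧
      ∀ x, (poly c).eval₂ (MvPolynomial.eval (v k x)) (y x) = 0 := by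
    intro k
    obtain ⟨Φ, hΦ0, hΦ, hΦeval⟩ := H k
    set c : J → ℂ := fun p => (Φ.coeff p.1.1).coeff p.1.2 with hc
    have hpc : poly c = Φ := poly_eq Φ hΦ
    have hc0 : c ≠ 0 := by
      rintro h0
      apply hΦ0
      rw [← hpc, h0]
      simp [hpoly]
    refine ⟨(‖c‖⁻¹ : ℂ) • c, by simp [norm_smul, hc0], fun x => ?_⟩
    have := hΦeval x
    rw [← hpc, eval_poly] at this
    rw [eval_poly]
    simp only [Pi.smul_apply, smul_eq_mul, mul_assoc, ← Finset.mul_sum]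
    simp only [mul_assoc] at this
    rw [this, mul_zero]
  choose c hc1 hc using Hc
  obtain ⟨a, ha, g, hg, hlim⟩ :=
    (isCompact_sphere (0 : J → ℂ) 1).tendsto_subseq (x := c) (by simpa using hc1)
  refine ⟨poly a, fun h0 => ?_, weight_poly a, fun x => ?_⟩
  · have ha0 : a = 0 := by
      ext p
      rw [← coeff_poly a p, h0]
      simp
    simp [ha0] at ha
  · rw [eval_poly]
    have hcont : Tendsto (fun k => ∑ p : J, c (g k) p * (∏ i, v (g k) x i ^ p.1.2 i) * y x ^ p.1.1)
        atTop (𝓝 (∑ p : J, a p * (∏ i, v' x i ^ p.1.2 i) * y x ^ p.1.1)) := by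
      refine tendsto_finsetSum _ fun p _ => Tendsto.mul_const _ (Tendsto.mul ?_ ?_)
      · exact (tendsto_pi_nhds.mp hlim) p
      · refine tendsto_finsetProd _ fun i _ => Tendsto.pow ?_ _
        exact (tendsto_pi_nhds.mp ((hv x).comp hg.tendsto_atTop)) i
    refine tendsto_nhds_unique hcont ?_
    simp_rw [← eval_poly, hc]
    exact tendsto_const_nhds

/-- The **Perron theorem**: `n` polynomials of degree at most `d` in `n` variables and a linear form
satisfy a nontrivial relation of weighted degree at most `d ^ n`. -/
theorem exists_relation_s15 {n d : ℕ} (hd : 0 < d) (f : Fin n → MvPolynomial (Fin n) ℂ)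
    (hdeg : ∀ i, (f i).totalDegree ≤ d) {l : MvPolynomial (Fin n) ℂ} (hl : l.totalDegree ≤ 1) :
    ∃ Φ : Polynomial (MvPolynomial (Fin n) ℂ), Φ ≠ 0 ∧ WeightLE d (d ^ n : ℕ) Φ ∧
      ∀ x : Fin n → ℂ, Φ.eval₂ (MvPolynomial.eval fun i => MvPolynomial.eval x (f i))
        (MvPolynomial.eval x l) = 0 := by
  set h : ℂ → Fin n → MvPolynomial (Fin n) ℂ := fun τ i =>
    MvPolynomial.X i ^ d + MvPolynomial.C τ * (f i - MvPolynomial.X i ^ d) with hh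
  set bad : Set ℂ := ⋃ D, {τ | (deformationMatrix d (h τ) D).det = 0}
  have hbad : bad.Countable := Set.countable_iUnion fun D =>
    (finite_setOf_det_deformationMatrix_eq_zero d D _).countable
  obtain ⟨τ, hτ, hlim⟩ := mem_closure_iff_seq_limit.mp (hbad.dense_compl ℂ (1 : ℂ))
  have hXdeg : ∀ i : Fin n, (MvPolynomial.X i ^ d : MvPolynomial (Fin n) ℂ).totalDegree ≤ d :=
    fun i => by rw [MvPolynomial.totalDegree_X_pow]
  have hhdeg : ∀ τ i, (h τ i).totalDegree ≤ d := by
    intro τ i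
    refine (MvPolynomial.totalDegree_add _ _).trans (max_le (hXdeg i) ?_)
    refine (MvPolynomial.totalDegree_mul _ _).trans ?_
    rw [MvPolynomial.totalDegree_C, zero_add]
    exact (MvPolynomial.totalDegree_sub _ _).trans (max_le (hdeg i) (hXdeg i))
  refine exists_relation_of_tendsto hd (v := fun k x i => MvPolynomial.eval x (h (τ k) i))
    (y := fun x => MvPolynomial.eval x l) (fun x => ?_) fun k => ?_
  · refine tendsto_pi_nhds.mpr fun i => ?_
    have : Tendsto (fun k => x i ^ d + τ k * (MvPolynomial.eval x (f i) - x i ^ d)) atTop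
        (𝓝 (x i ^ d + 1 * (MvPolynomial.eval x (f i) - x i ^ d))) :=
      (hlim.mul_const _).const_add _
    simpa [hh] using this
  · obtain ⟨Φ, h0, hw, he⟩ := exists_relation_of_det_ne_zero hd (hhdeg (τ k))
      (fun D hD => hτ k (Set.mem_iUnion.mpr ⟨D, hD⟩)) hl
    refine ⟨Φ, h0, hw, fun x => ?_⟩
    have := congrArg (MvPolynomial.eval x) he
    rw [Polynomial.hom_eval₂, map_zero] at this
    rw [← this]
    congr 1
    refine MvPolynomial.ringHom_ext (fun c => by simp) fun i => by simp

/-- If `Φ(u, z) = 0` along a filter with `u → a` and `z → ∞`, the leading coefficient of `Φ`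
vanishes at `a`. -/
lemma eval_leadingCoeff_eq_zero {n : ℕ} {Φ : Polynomial (MvPolynomial (Fin n) ℂ)}
    {ι : Type*} {L : Filter ι} [L.NeBot] {u : ι → Fin n → ℂ} {z : ι → ℂ} {a : Fin n → ℂ}
    (hu : Tendsto u L (𝓝 a)) (hz : Tendsto (fun k => ‖z k‖) L atTop)
    (h : ∀ k, Φ.eval₂ (MvPolynomial.eval (u k)) (z k) = 0) :
    MvPolynomial.eval a Φ.leadingCoeff = 0 := by
  have hcont : ∀ p : MvPolynomial (Fin n) ℂ,
      Tendsto (fun k => MvPolynomial.eval (u k) p) L (𝓝 (MvPolynomial.eval a p)) := fun p =>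
    (MvPolynomial.continuous_eval p).continuousAt.tendsto.comp hu
  have hinv : Tendsto (fun k => (z k)⁻¹) L (𝓝 0) :=
    tendsto_inv₀_cobounded.comp (tendsto_norm_atTop_iff_cobounded.mp hz)
  set N := Φ.natDegree with hN
  have hlim : Tendsto (fun k => -∑ j ∈ Finset.range N,
      MvPolynomial.eval (u k) (Φ.coeff j) * (z k)⁻¹ ^ (N - j)) L (𝓝 0) := by
    have : Tendsto (fun k => -∑ j ∈ Finset.range N,
        MvPolynomial.eval (u k) (Φ.coeff j) * (z k)⁻¹ ^ (N - j)) L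
        (𝓝 (-∑ j ∈ Finset.range N, MvPolynomial.eval a (Φ.coeff j) * 0 ^ (N - j))) :=
      (tendsto_finsetSum _ fun j _ => (hcont _).mul (hinv.pow _)).neg
    rw [Finset.sum_eq_zero, neg_zero] at this
    · exact this
    · intro j hj
      rw [zero_pow (Nat.sub_ne_zero_of_lt (Finset.mem_range.mp hj)), mul_zero]
  refine tendsto_nhds_unique (hcont Φ.leadingCoeff) (hlim.congr' ?_)
  filter_upwards [hz.eventually_gt_atTop 0] with k hk
  have hzk : z k ≠ 0 := norm_pos_iff.mp hk
  have := h k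
  rw [Polynomial.eval₂_eq_sum_range, Finset.sum_range_succ] at this
  have hsum : ∑ j ∈ Finset.range N, MvPolynomial.eval (u k) (Φ.coeff j) * z k ^ j =
      (∑ j ∈ Finset.range N, MvPolynomial.eval (u k) (Φ.coeff j) * (z k)⁻¹ ^ (N - j)) *
        z k ^ N := by
    rw [Finset.sum_mul]
    refine Finset.sum_congr rfl fun j hj => ?_
    have hjN : N = (N - j) + j := (Nat.sub_add_cancel (Finset.mem_range.mp hj).le).symm
    conv_rhs => rw [hjN, pow_add, Nat.add_sub_cancel, inv_pow]
    field_simp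
  rw [hsum, ← add_mul] at this
  have := (mul_eq_zero.mp this).resolve_right (pow_ne_zero _ hzk)
  exact (eq_neg_of_add_eq_zero_right this).symm

/-- For a dominant quadratic mapping of `ℂ³`, the points approached along sequences on which a
given linear form is unbounded lie on a surface of degree at most three. -/
lemma exists_cubic {P : Fin 3 → MvPolynomial (Fin 3) ℂ} (hP : ∀ i, (P i).totalDegree ≤ 2)
    (hdom : Dense (Set.range fun (x : Fin 3 → ℂ) i => MvPolynomial.eval x (P i)))
    {l : MvPolynomial (Fin 3) ℂ} (hl : l.totalDegree ≤ 1) :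
    ∃ A : MvPolynomial (Fin 3) ℂ, A ≠ 0 ∧ A.totalDegree ≤ 3 ∧
      ∀ (L : Filter ℕ) [L.NeBot] (ξ : ℕ → Fin 3 → ℂ) (a : Fin 3 → ℂ),
        Tendsto (fun k i => MvPolynomial.eval (ξ k) (P i)) L (𝓝 a) →
        Tendsto (fun k => ‖MvPolynomial.eval (ξ k) l‖) L atTop → MvPolynomial.eval a A = 0 := by
  obtain ⟨Φ, h0, hw, he⟩ := exists_relation_s15 two_pos P hP hl
  refine ⟨Φ.leadingCoeff, Polynomial.leadingCoeff_ne_zero.mpr h0, ?_, fun L _ ξ a hu hz =>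
    eval_leadingCoeff_eq_zero hu hz fun k => he (ξ k)⟩
  have hN : Φ.natDegree ≠ 0 := by
    intro hN
    rw [Polynomial.eq_C_of_natDegree_eq_zero hN] at he h0
    refine h0 ?_
    suffices Φ.coeff 0 = 0 by rw [this, map_zero]
    refine MvPolynomial.funext fun a => ?_
    have hclosed : IsClosed {a | MvPolynomial.eval a (Φ.coeff 0) = 0} :=
      isClosed_eq (MvPolynomial.continuous_eval _) continuous_const
    have hsub : Set.range (fun (x : Fin 3 → ℂ) i => MvPolynomial.eval x (P i)) ⊆
        {a | MvPolynomial.eval a (Φ.coeff 0) = 0} := by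
      rintro _ ⟨x, rfl⟩
      simpa using he x
    simpa using hclosed.closure_subset_iff.mpr hsub (hdom a)
  refine Finset.sup_le fun m hm => ?_
  have := hw Φ.natDegree m (MvPolynomial.mem_support_iff.mp hm)
  change m.degree ≤ 3
  norm_num at this
  omega

/-- The linear forms `x₀ + c x₁ + c² x₂`. -/
noncomputable def momentForm (c : ℕ) : MvPolynomial (Fin 3) ℂ :=
  ∑ i : Fin 3, MvPolynomial.C ((c : ℂ) ^ (i : ℕ)) * MvPolynomial.X i

lemma totalDegree_momentForm_le (c : ℕ) : (momentForm c).totalDegree ≤ 1 := by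
  refine MvPolynomial.totalDegree_finsetSum_le fun i _ => ?_
  refine (MvPolynomial.totalDegree_mul _ _).trans ?_
  rw [MvPolynomial.totalDegree_C, MvPolynomial.totalDegree_X]

/-- Three distinct moment forms bound the norm. -/
lemma exists_norm_le_momentForm {c : Fin 3 → ℕ} (hc : Function.Injective c) :
    ∃ K : ℝ, 0 < K ∧ ∀ x : Fin 3 → ℂ, ∃ i, ‖x‖ ≤ K * ‖MvPolynomial.eval x (momentForm (c i))‖ := by
  set V := Matrix.vandermonde fun i => (c i : ℂ) with hV
  have hdet : IsUnit V.det := isUnit_iff_ne_zero.mpr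
    (Matrix.det_vandermonde_ne_zero_iff.mpr (Nat.cast_injective.comp hc))
  have hVx : ∀ x i, V.mulVec x i = MvPolynomial.eval x (momentForm (c i)) := by
    intro x i
    simp [hV, momentForm, Matrix.mulVec, dotProduct, Matrix.vandermonde_apply]
  set T := LinearMap.toContinuousLinearMap (Matrix.toLin' V⁻¹)
  refine ⟨‖T‖ + 1, by positivity, fun x => ?_⟩
  by_contra! hlt
  have hx : x = T (V.mulVec x) := by
    simp [T, Matrix.mulVec_mulVec, Matrix.nonsing_inv_mul _ hdet]
  have hx0 : 0 < ‖x‖ := (by positivity : (0 : ℝ) ≤ _).trans_lt (hlt 0)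
  have hK : 0 < ‖T‖ + 1 := by positivity
  have hVlt : ‖V.mulVec x‖ < ‖x‖ / (‖T‖ + 1) := by
    rw [pi_norm_lt_iff (by positivity)]
    intro i
    rw [hVx, lt_div_iff₀' hK]
    exact hlt i
  have h₁ : ‖x‖ ≤ ‖T‖ * ‖V.mulVec x‖ := by
    conv_lhs => rw [hx]
    exact T.le_opNorm _
  rw [lt_div_iff₀' hK] at hVlt
  nlinarith [norm_nonneg (V.mulVec x)]

/-- The defining polynomials of the sets under consideration: prime polynomials that generate the
ideal of their zero locus. -/
structure IsPrimeEquation (q : MvPolynomial (Fin 3) ℂ) : Prop where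
  prime : Prime q
  dvd : ∀ p, (∀ x, MvPolynomial.eval x q = 0 → MvPolynomial.eval x p = 0) → q ∣ p

/-- A graph `s xⱼ + g = 0`, with `s ≠ 0` and `g` not involving `xⱼ`, is cut out by a prime
equation. -/
lemma isPrimeEquation_graph {j : Fin 3} {s : ℂ} (hs : s ≠ 0) {g : MvPolynomial (Fin 3) ℂ}
    (hg : ∀ r, MvPolynomial.aeval (Function.update MvPolynomial.X j r) g = g)
    (h0 : MvPolynomial.C s * MvPolynomial.X j + g ≠ 0) :
    IsPrimeEquation (MvPolynomial.C s * MvPolynomial.X j + g) := by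
  set q := MvPolynomial.C s * MvPolynomial.X j + g with hq
  have hCs : (MvPolynomial.C s * MvPolynomial.C s⁻¹ : MvPolynomial (Fin 3) ℂ) = 1 := by
    rw [← map_mul, mul_inv_cancel₀ hs, map_one]
  set r : MvPolynomial (Fin 3) ℂ := -(MvPolynomial.C s⁻¹ * g) with hr
  set φ : MvPolynomial (Fin 3) ℂ →ₐ[ℂ] MvPolynomial (Fin 3) ℂ :=
    MvPolynomial.aeval (Function.update MvPolynomial.X j r) with hφ
  have hφq : φ q = 0 := by
    rw [hq, map_add, hφ, hg, map_mul, MvPolynomial.aeval_X, Function.update_self,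
      MvPolynomial.aeval_C, MvPolynomial.algebraMap_eq, hr]
    linear_combination -g * hCs
  have hsub : ∀ p, q ∣ p - φ p := by
    intro p
    rw [← Ideal.mem_span_singleton, ← Ideal.Quotient.mk_eq_mk_iff_sub_mem]
    have : (Ideal.Quotient.mkₐ ℂ (Ideal.span {q})) =
        (Ideal.Quotient.mkₐ ℂ (Ideal.span {q})).comp φ := by
      refine MvPolynomial.algHom_ext fun i => ?_
      simp only [AlgHom.comp_apply, hφ, MvPolynomial.aeval_X, Ideal.Quotient.mkₐ_eq_mk]
      rw [Ideal.Quotient.mk_eq_mk_iff_sub_mem, Ideal.mem_span_singleton]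
      by_cases hij : i = j
      · subst hij
        rw [Function.update_self]
        exact ⟨MvPolynomial.C s⁻¹, by rw [hr, hq]; linear_combination -MvPolynomial.X i * hCs⟩
      · simp [Function.update_of_ne hij]
    exact DFunLike.congr_fun this p
  have hdvd : ∀ p, φ p = 0 → q ∣ p := fun p hp => by simpa [hp] using hsub p
  refine ⟨⟨h0, fun hu => ?_, fun a b hab => ?_⟩, fun p hp => ?_⟩
  · have := hu.map φ
    rw [hφq] at this
    exact not_isUnit_zero this
  · obtain ⟨e, he⟩ := hab
    have : φ a * φ b = 0 := by rw [← map_mul, he, map_mul, hφq, zero_mul]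
    exact (mul_eq_zero.mp this).imp (hdvd a) (hdvd b)
  · refine hdvd p (MvPolynomial.funext fun x => ?_)
    have heval : ∀ p, MvPolynomial.eval x (φ p) =
        MvPolynomial.eval (fun i => MvPolynomial.eval x (Function.update MvPolynomial.X j r i)) p :=
      DFunLike.congr_fun <| show (MvPolynomial.eval x).comp φ.toRingHom = _ from
        MvPolynomial.ringHom_ext (fun c => by simp [hφ]) fun i => by simp [hφ]
    rw [heval, map_zero]
    apply hp
    rw [← heval, hφq, map_zero]

lemma IsPlane.exists_isPrimeEquation {S : Set (Fin 3 → ℂ)} (hS : IsPlane S) :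
    ∃ q, IsPrimeEquation q ∧ q.totalDegree = 1 ∧ S = {x | MvPolynomial.eval x q = 0} := by
  obtain ⟨Q, hQ, rfl⟩ := hS
  refine ⟨Q, ?_, hQ, rfl⟩
  have hQ0 : Q ≠ 0 := by
    rintro rfl
    simp at hQ
  have single_of_degree : ∀ m : Fin 3 →₀ ℕ, m.degree = 1 → ∃ j, Finsupp.single j 1 = m := by
    intro m hm
    have : m ∈ Set.range fun j : Fin 3 => Finsupp.single j 1 := by
      rw [Finsupp.range_single_one]
      exact hm
    exact this
  obtain ⟨j, hj⟩ : ∃ j, Q.coeff (Finsupp.single j 1) ≠ 0 := by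
    obtain ⟨m, hm, hmdeg⟩ := Finset.exists_mem_eq_sup Q.support
      (MvPolynomial.support_nonempty.mpr hQ0) fun s => s.sum fun _ e => e
    obtain ⟨j, rfl⟩ := single_of_degree m (hmdeg.symm.trans hQ)
    exact ⟨j, MvPolynomial.mem_support_iff.mp hm⟩
  set s := Q.coeff (Finsupp.single j 1) with hs
  set g := Q - MvPolynomial.C s * MvPolynomial.X j with hg
  have hQg : Q = MvPolynomial.C s * MvPolynomial.X j + g := by rw [hg]; ring
  have hgj : j ∉ g.vars := by
    rw [MvPolynomial.mem_vars_iff_mem_support]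
    rintro ⟨m, hm, hmj⟩
    rw [MvPolynomial.mem_support_iff] at hm
    have hmdeg : m.degree ≤ 1 := by
      by_contra! hlt
      apply hm
      rw [hg, MvPolynomial.coeff_sub, coeff_eq_zero_of_totalDegree_lt_degree (hQ ▸ hlt),
        coeff_eq_zero_of_totalDegree_lt_degree, sub_zero]
      refine ((MvPolynomial.totalDegree_mul _ _).trans ?_).trans_lt hlt
      simp
    have hmj' : 1 ≤ m j := Nat.one_le_iff_ne_zero.mpr (Finsupp.mem_support_iff.mp hmj)
    have hle := Finsupp.le_degree j m
    obtain ⟨i, rfl⟩ := single_of_degree m (by omega)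
    have hij : i = j := by
      by_contra hij
      simp [hij] at hmj'
    subst hij
    simp [hg, hs, MvPolynomial.coeff_C_mul] at hm
  rw [hQg] at hQ0 ⊢
  refine isPrimeEquation_graph hj (fun r => ?_) hQ0
  have := MvPolynomial.hom_congr_vars
    (f₁ := (MvPolynomial.aeval (Function.update MvPolynomial.X j r) :
      MvPolynomial (Fin 3) ℂ →ₐ[ℂ] MvPolynomial (Fin 3) ℂ).toRingHom)
    (f₂ := RingHom.id _) (p₁ := g) (p₂ := g)
    (by ext; simp [MvPolynomial.algebraMap_eq]) (fun i hi _ => ?_) rfl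
  · simpa using this
  · have hij : i ≠ j := fun h => hgj (h ▸ hi)
    simp [Function.update_of_ne hij]

lemma IsParaboloid.exists_isPrimeEquation {S : Set (Fin 3 → ℂ)} (hS : IsParaboloid S) :
    ∃ q, IsPrimeEquation q ∧ 2 ≤ q.totalDegree ∧ S = {x | MvPolynomial.eval x q = 0} := by
  obtain ⟨i, j, l, r, s, t, u, hij, hjl, hil, hr, hst, rfl⟩ := hS
  wlog hs : s ≠ 0 generalizing j l s t
  · have ht : t ≠ 0 := by
      rintro rfl
      exact hst (by rw [not_not.mp hs])
    obtain ⟨q, hq, hdeg, hS⟩ := this l j t s hil hjl.symm hij (by simp [ht]) ht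
    refine ⟨q, hq, hdeg, hS ▸ ?_⟩
    ext x
    simp only [Set.mem_ofPred_eq]
    ring_nf
  set g : MvPolynomial (Fin 3) ℂ := MvPolynomial.C r * MvPolynomial.X i ^ 2 +
    MvPolynomial.C t * MvPolynomial.X l + MvPolynomial.C u with hg
  set q := MvPolynomial.C s * MvPolynomial.X j + g with hq
  have hcoeff : q.coeff (Finsupp.single i 2) ≠ 0 := by
    have h₁ : ∀ k : Fin 3, Finsupp.single k 1 ≠ Finsupp.single i 2 := fun k hk => by
      simpa using congrArg Finsupp.degree hk
    have h₂ : (0 : Fin 3 →₀ ℕ) ≠ Finsupp.single i 2 := fun hk => by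
      simpa using congrArg Finsupp.degree hk
    simpa [hq, hg, MvPolynomial.coeff_C_mul, MvPolynomial.coeff_X, MvPolynomial.coeff_X_pow,
      MvPolynomial.coeff_C, h₁, h₂] using hr
  have h0 : q ≠ 0 := by
    intro h
    simp [h] at hcoeff
  refine ⟨q, isPrimeEquation_graph hs (fun r => ?_) h0, ?_, ?_⟩
  · simp [hg, Function.update_of_ne hij, Function.update_of_ne hjl.symm,
      MvPolynomial.algebraMap_eq]
  · simpa using MvPolynomial.le_totalDegree (MvPolynomial.mem_support_iff.mpr hcoeff)
  · ext x
    simp only [Set.mem_ofPred_eq, hq, hg, map_add, map_mul, map_pow, MvPolynomial.eval_C,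
      MvPolynomial.eval_X]
    ring_nf

/-- If any three members of a family of polynomials cover the zero locus of a prime equation `q`,
then `q` divides all but finitely many of them. -/
lemma IsPrimeEquation.finite_not_dvd {q : MvPolynomial (Fin 3) ℂ} (hq : IsPrimeEquation q)
    {A : ℕ → MvPolynomial (Fin 3) ℂ}
    (h : ∀ c : Fin 3 → ℕ, Function.Injective c → ∀ x, MvPolynomial.eval x q = 0 →
      ∃ i, MvPolynomial.eval x (A (c i)) = 0) : {c | ¬ q ∣ A c}.Finite := by
  by_contra hinf
  set e := (show {c | ¬ q ∣ A c}.Infinite from hinf).natEmbedding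
  set c : Fin 3 → ℕ := fun i => e i with hc
  have hcinj : Function.Injective c := fun i i' hii =>
    Fin.ext (e.injective (Subtype.ext hii))
  have hprod : q ∣ ∏ i, A (c i) := hq.dvd _ fun x hx => by
    obtain ⟨i, hi⟩ := h c hcinj x hx
    rw [map_prod]
    exact Finset.prod_eq_zero (Finset.mem_univ i) hi
  obtain ⟨i, -, hi⟩ := (hq.prime.dvd_finsetProd_iff _).mp hprod
  exact (e i).2 hi

/-- The asymptotic set of a non-proper dominant degree-2 polynomial mapping `F : ℂ³ → ℂ³`
cannot simultaneously contain a paraboloid and two distinct planes. -/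
theorem not_paraboloid_and_two_planes
    (P : Fin 3 → MvPolynomial (Fin 3) ℂ) (F : (Fin 3 → ℂ) → (Fin 3 → ℂ))
    (hP : IsDegTwoPolyMap P F)
    (hdom : Dense (Set.range F))
    (hne : asymptoticSet F ≠ ∅) :
    ¬ ∃ (H S₁ S₂ : Set (Fin 3 → ℂ)), IsParaboloid H ∧ IsPlane S₁ ∧ IsPlane S₂ ∧ S₁ ≠ S₂ ∧
      H ⊆ asymptoticSet F ∧ S₁ ⊆ asymptoticSet F ∧ S₂ ⊆ asymptoticSet F := by
  rintro ⟨H, S₁, S₂, hH, hS₁, hS₂, hS, hHF, hS₁F, hS₂F⟩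
  obtain ⟨hF, hdeg, -⟩ := hP
  obtain rfl : F = fun x i => MvPolynomial.eval x (P i) := by
    ext x i
    exact hF x i
  choose A hA0 hAdeg hA using fun c =>
    exists_cubic hdeg hdom (totalDegree_momentForm_le c)
  have hcover : ∀ c : Fin 3 → ℕ, Function.Injective c →
      ∀ a ∈ asymptoticSet (fun (x : Fin 3 → ℂ) i => MvPolynomial.eval x (P i)),
      ∃ i, MvPolynomial.eval a (A (c i)) = 0 := by
    rintro c hc a ⟨ξ, hξ, ha⟩
    obtain ⟨K, hK, hbound⟩ := exists_norm_le_momentForm hc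
    obtain ⟨i, hi⟩ : ∃ i, ∃ᶠ k in atTop,
        ‖ξ k‖ ≤ K * ‖MvPolynomial.eval (ξ k) (momentForm (c i))‖ := by
      by_contra! hnot
      obtain ⟨k, hk⟩ := (eventually_all.mpr fun i => hnot i).exists
      obtain ⟨i, hi⟩ := hbound (ξ k)
      exact (hk i).not_ge hi
    set T : Set ℕ := {k | ‖ξ k‖ ≤ K * ‖MvPolynomial.eval (ξ k) (momentForm (c i))‖}
    have : (atTop ⊓ 𝓟 T).NeBot :=
      frequently_mem_iff_neBot.mp hi
    refine ⟨i, hA (c i) (atTop ⊓ 𝓟 T) ξ a (ha.mono_left inf_le_left) ?_⟩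
    refine tendsto_atTop_mono' _ ?_ ((hξ.mono_left inf_le_left).atTop_div_const hK)
    filter_upwards [mem_inf_of_right (mem_principal_self T)] with k hk
    rw [div_le_iff₀' hK]
    exact hk
  obtain ⟨q, hq, hqdeg, rfl⟩ := hH.exists_isPrimeEquation
  obtain ⟨q₁, hq₁, hq₁deg, rfl⟩ := hS₁.exists_isPrimeEquation
  obtain ⟨q₂, hq₂, hq₂deg, rfl⟩ := hS₂.exists_isPrimeEquation
  have hfin := ((hq.finite_not_dvd fun c hc x hx => hcover c hc x (hHF hx)).union
    (hq₁.finite_not_dvd fun c hc x hx => hcover c hc x (hS₁F hx))).union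
    (hq₂.finite_not_dvd fun c hc x hx => hcover c hc x (hS₂F hx))
  obtain ⟨c, hc⟩ := hfin.exists_notMem
  simp only [Set.mem_union, Set.mem_ofPred_eq, not_or, not_not] at hc
  obtain ⟨⟨⟨B, hB⟩, h₁⟩, h₂⟩ := hc
  have hnot : ∀ p, IsPrimeEquation p → p.totalDegree = 1 → ¬ p ∣ q := by
    intro p hp hpdeg hpq
    have := (hp.prime.irreducible.associated_of_dvd hq.prime.irreducible hpq).symm.dvd
    have := MvPolynomial.totalDegree_le_of_dvd_of_isDomain this hp.prime.ne_zero
    omega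
  have hnot₁₂ : ¬ q₂ ∣ q₁ := by
    intro h
    have h' := (hq₂.prime.irreducible.associated_of_dvd hq₁.prime.irreducible h).symm.dvd
    apply hS
    ext x
    have aux : ∀ {p p' : MvPolynomial (Fin 3) ℂ}, p ∣ p' → MvPolynomial.eval x p = 0 →
        MvPolynomial.eval x p' = 0 := fun hpp hx =>
      zero_dvd_iff.mp (hx ▸ map_dvd (MvPolynomial.eval x) hpp)
    exact ⟨aux h', aux h⟩
  rw [hB] at h₁ h₂
  obtain ⟨B₁, rfl⟩ := (hq₁.prime.dvd_or_dvd h₁).resolve_left (hnot _ hq₁ hq₁deg)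
  have h₂' := (hq₂.prime.dvd_or_dvd h₂).resolve_left (hnot _ hq₂ hq₂deg)
  obtain ⟨B₂, rfl⟩ := (hq₂.prime.dvd_or_dvd h₂').resolve_left hnot₁₂
  have hA0c := hA0 c
  have hAc := hAdeg c
  rw [hB] at hA0c hAc
  have n₁ := right_ne_zero_of_mul hA0c
  have n₂ := right_ne_zero_of_mul n₁
  rw [MvPolynomial.totalDegree_mul_of_isDomain hq.prime.ne_zero n₁,
    MvPolynomial.totalDegree_mul_of_isDomain hq₁.prime.ne_zero n₂,
    MvPolynomial.totalDegree_mul_of_isDomain hq₂.prime.ne_zero (right_ne_zero_of_mul n₂)] at hAc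
  omega
end
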